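/- Let h be a positive even integer and ϑ > 3/4. Assume Hypothesis D(ϑ, h). Then there exist infinitely many primes p such that p + h is also prime. -/

import Mathlib

open Filter

/-- The Liouville function `λ(n) = (-1)^Ω(n)`. -/
noncomputable def lio (n : ℕ) : ℝ := (-1) ^ n.primeFactorsList.length

/-- `θ(n) = log n` if `n` is prime, `0` otherwise. -/
noncomputable def theta (n : ℕ) : ℝ := if n.Prime then Real.log n else 0

/-- `max_a |∑_{n ≤ N, n ≡ a (q)} f(n)|`. -/
noncomputable def maxAbs (f : ℕ → ℝ) (q N : ℕ) : ℝ :=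
  ⨆ a : ℕ, |∑ n ∈ Finset.Icc 1 N, if n % q = a % q then f n else 0|

/-- `f` has (zero-mean) distribution level `ϑ`. -/
def HasLevel (f : ℕ → ℝ) (ϑ : ℝ) : Prop :=
  ∀ ε > (0 : ℝ), ∀ A > (0 : ℝ), ∃ C > (0 : ℝ), ∀ N : ℕ, 2 ≤ N →
    ∑ q ∈ Finset.Icc 1 ⌊(N : ℝ) ^ (ϑ - ε)⌋₊, maxAbs f q N ≤ C * N / Real.log N ^ A

/-- `max_{(a,q)=1} |∑_{p ≤ N, p ≡ a (q)} log p - N/φ(q)|`. -/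
noncomputable def primeMaxAbs (q N : ℕ) : ℝ :=
  ⨆ a : ℕ, if Nat.Coprime a q then
    |(∑ p ∈ Finset.Icc 1 N, if p.Prime ∧ p % q = a % q then Real.log p else 0)
      - N / q.totient|
  else 0

/-- The primes have distribution level `ϑ` (Bombieri–Vinogradov/Elliott–Halberstam type). -/
def PrimesLevel (ϑ : ℝ) : Prop :=
  ∀ ε > (0 : ℝ), ∀ A > (0 : ℝ), ∃ C > (0 : ℝ), ∀ N : ℕ, 2 ≤ N →
    ∑ q ∈ Finset.Icc 1 ⌊(N : ℝ) ^ (ϑ - ε)⌋₊, primeMaxAbs q N ≤ C * N / Real.log N ^ A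

/-- Hypothesis D(ϑ, h): the primes and the four auxiliary Liouville-type sequences
all have distribution level `ϑ`. -/
def HypD (ϑ : ℝ) (h : ℕ) : Prop :=
  PrimesLevel ϑ ∧
  HasLevel lio ϑ ∧
  HasLevel (fun n => lio n * lio (n + h)) ϑ ∧
  HasLevel (fun n => theta n * lio (n + h)) ϑ ∧
  HasLevel (fun n => if h < n then theta n * lio (n - h) else 0) ϑ

/-- The Goldston–Pintz–Yıldırım weight
`Λ_R(n; H, l) = (1/(k+l)!) ∑_{d ≤ R, d ∣ P_H(n)} μ(d) (log (R/d))^{k+l}`. -/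
noncomputable def LambdaR (R : ℝ) (n : ℕ) (H : Finset ℕ) (l : ℕ) : ℝ :=
  (1 / (H.card + l).factorial) *
    ∑ d ∈ Finset.Icc 1 ⌊R⌋₊,
      if d ∣ ∏ hi ∈ H, (n + hi) then
        (ArithmeticFunction.moebius d : ℝ) * Real.log (R / d) ^ (H.card + l)
      else 0

/-- `ν_m(H)`: the number of residue classes `n` mod `m` with `m ∣ P_H(n)`. -/
def nu (H : Finset ℕ) (m : ℕ) : ℕ :=
  ((Finset.range m).filter fun n => m ∣ ∏ hi ∈ H, (n + hi)).card

/-- The singular series `𝔖(H) = ∏_p (1 - ν_p(H)/p)(1 - 1/p)^{-k}`. -/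
noncomputable def singSeries (H : Finset ℕ) : ℝ :=
  ∏' p : Nat.Primes, (1 - (nu H p : ℝ) / (p : ℕ)) * (1 - 1 / ((p : ℕ) : ℝ)) ^ (-(H.card : ℤ))

/-- `𝔖₀(h) = ∏_{p ∣ h} (1-1/p)⁻¹ ∏_{p ∤ h} (1 - 1/(p-1)²)`. -/
noncomputable def singSeries0 (h : ℕ) : ℝ :=
  ∏' p : Nat.Primes, if (p : ℕ) ∣ h then (1 - 1 / ((p : ℕ) : ℝ))⁻¹
    else 1 - 1 / (((p : ℕ) : ℝ) - 1) ^ 2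

/-- The coefficient `μ(d)/φ(d)` restricted to `d` coprime to `h`. -/
noncomputable def singCoeff (h d : ℕ) : ℝ :=
  if d.Coprime h then (ArithmeticFunction.moebius d : ℝ) / d.totient else 0

/-- The logarithmically weighted partial sum `∑_{d ≤ x, (d,h)=1} μ(d)/φ(d) log (x/d)`. -/
noncomputable def singPartial (h : ℕ) (x : ℝ) : ℝ :=
  ∑ d ∈ Finset.Icc 1 ⌊x⌋₊, singCoeff h d * Real.log (x / d)

lemma abs_moebius_le_one_real (d : ℕ) : |(ArithmeticFunction.moebius d : ℝ)| ≤ 1 := by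
  exact_mod_cast ArithmeticFunction.abs_moebius_le_one (n := d)

lemma le_card_divisors_mul_totient (d : ℕ) : d ≤ d.divisors.card * d.totient := by
  rcases Nat.eq_zero_or_pos d with rfl | hd
  · simp
  calc d = ∑ e ∈ d.divisors, e.totient := (Nat.sum_totient d).symm
    _ ≤ ∑ _e ∈ d.divisors, d.totient := by
        refine Finset.sum_le_sum fun e he => ?_
        exact Nat.le_of_dvd (Nat.totient_pos.2 hd)
          (Nat.totient_dvd_of_dvd (Nat.dvd_of_mem_divisors he))
    _ = _ := by simp

lemma abs_singCoeff_le (h d : ℕ) : |singCoeff h d| ≤ d.divisors.card / d := by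
  unfold singCoeff
  split_ifs
  · rcases Nat.eq_zero_or_pos d with rfl | hd
    · simp
    have hφ : (0 : ℝ) < d.totient := by exact_mod_cast Nat.totient_pos.2 hd
    have hd' : (0 : ℝ) < d := by exact_mod_cast hd
    rw [abs_div, abs_of_pos hφ, div_le_div_iff₀ hφ hd']
    have h1 := abs_moebius_le_one_real d
    have h2 : (d : ℝ) ≤ d.divisors.card * d.totient := by
      exact_mod_cast le_card_divisors_mul_totient d
    nlinarith
  · simp; positivity

lemma summable_card_divisors_mul_rpow {s : ℝ} (hs : 0 < s) :
    Summable fun n : ℕ => (n.divisors.card : ℝ) / n * (n : ℝ) ^ (-s) := by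
  have hz : LSeriesSummable 1 ((1 + s : ℝ) : ℂ) := by
    rw [LSeriesSummable_one_iff]; simpa using hs
  have h1 := (hz.convolution hz).norm
  refine h1.congr fun n => ?_
  rcases Nat.eq_zero_or_pos n with rfl | hn
  · simp
  have hn' : (0 : ℝ) < n := by exact_mod_cast hn
  rw [LSeries.norm_term_eq, if_neg hn.ne', LSeries.convolution_def]
  simp only [Pi.one_apply, mul_one, Finset.sum_const, nsmul_eq_mul, Complex.norm_natCast,
    Complex.ofReal_re]
  rw [← Nat.map_div_right_divisors, Finset.card_map, Real.rpow_neg hn'.le, Real.rpow_add hn',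
    Real.rpow_one]
  field_simp

lemma summable_abs_singCoeff_mul_rpow (h : ℕ) {s : ℝ} (hs : 0 < s) :
    Summable fun n : ℕ => |singCoeff h n * (n : ℝ) ^ (-s)| := by
  refine (summable_card_divisors_mul_rpow hs).of_nonneg_of_le (fun _ => abs_nonneg _) fun n => ?_
  rw [abs_mul, abs_of_nonneg (Real.rpow_nonneg (Nat.cast_nonneg n) _)]
  exact mul_le_mul_of_nonneg_right (abs_singCoeff_le h n) (Real.rpow_nonneg (Nat.cast_nonneg n) _)

lemma prod_one_sub_inv_sq (n : ℕ) :
    (1 : ℝ) / 2 ≤ ∏ k ∈ Finset.Ico 2 (n + 2), ((1 : ℝ) - 1 / ((k : ℕ) : ℝ) ^ 2) := by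
  have key : ∏ k ∈ Finset.Ico 2 (n + 2), ((1 : ℝ) - 1 / ((k : ℕ) : ℝ) ^ 2) = ((n : ℝ) + 2) / (2 * ((n : ℝ) + 1)) := by
    induction n with
    | zero => norm_num
    | succ n ih =>
      rw [show n + 1 + 2 = (n + 2) + 1 by ring, Finset.prod_Ico_succ_top (by omega), ih]
      push_cast
      field_simp
      ring
  rw [key, div_le_div_iff₀ (by norm_num) (by positivity)]
  linarith

lemma prod_primes_ge_half (h : ℕ) (heven : Even h) (S : Finset Nat.Primes) :
    (1 : ℝ) / 2 ≤ ∏ p ∈ S, if ((p : ℕ)).Coprime h then 1 - 1 / ((p : ℝ) - 1) ^ 2 else 1 := by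
  classical
  rw [Finset.prod_ite, Finset.prod_const_one, mul_one]
  set S' := S.filter fun p : Nat.Primes => (p : ℕ).Coprime h
  have h3 : ∀ p ∈ S', 3 ≤ (p : ℕ) := by
    intro p hp
    have hp2 := (Finset.mem_filter.1 hp).2
    have := p.2.two_le
    rcases this.lt_or_eq with h' | h'
    · exact h'
    · rw [← h'] at hp2
      exact absurd (Nat.coprime_two_left.1 hp2) (by simpa using heven)
  have hinj : Set.InjOn (fun p : Nat.Primes => (p : ℕ) - 1) S' := by
    intro p hp q hq hpq
    have h1 := h3 p hp
    have h2 := h3 q hq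
    simp only at hpq
    exact Subtype.ext (by omega)
  have him : ∏ p ∈ S', ((1 : ℝ) - 1 / (((p : ℕ) : ℝ) - 1) ^ 2)
      = ∏ k ∈ S'.image (fun p : Nat.Primes => (p : ℕ) - 1), ((1 : ℝ) - 1 / ((k : ℕ) : ℝ) ^ 2) := by
    rw [Finset.prod_image hinj]
    refine Finset.prod_congr rfl fun p hp => ?_
    rw [Nat.cast_sub (by have := h3 p hp; omega), Nat.cast_one]
  rw [him]
  set I := S'.image (fun p : Nat.Primes => (p : ℕ) - 1)
  have hI2 : ∀ k ∈ I, 2 ≤ k := by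
    intro k hk
    obtain ⟨p, hp, rfl⟩ := Finset.mem_image.1 hk
    have := h3 p hp
    omega
  have hsub : I ⊆ Finset.Ico 2 (I.sup id + 2) := by
    intro k hk
    have : k ≤ I.sup id := Finset.le_sup (f := id) hk
    exact Finset.mem_Ico.2 ⟨hI2 k hk, by omega⟩
  refine (prod_one_sub_inv_sq (I.sup id)).trans ?_
  rw [← Finset.prod_sdiff hsub]
  have hfac : ∀ k ∈ Finset.Ico 2 (I.sup id + 2), (0 : ℝ) ≤ 1 - 1 / (k : ℝ) ^ 2 ∧
      1 - 1 / (k : ℝ) ^ 2 ≤ 1 := by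
    intro k hk
    have hk2 : (2 : ℝ) ≤ k := by exact_mod_cast (Finset.mem_Ico.1 hk).1
    have : 1 / (k : ℝ) ^ 2 ≤ 1 := by
      rw [div_le_one (by positivity)]; nlinarith
    have h0 : 0 ≤ 1 / (k : ℝ) ^ 2 := by positivity
    constructor <;> linarith
  refine mul_le_of_le_one_left (Finset.prod_nonneg fun k hk => (hfac k (hsub hk)).1) ?_
  exact Finset.prod_le_one (fun k hk => (hfac k (Finset.sdiff_subset hk)).1)
    fun k hk => (hfac k (Finset.sdiff_subset hk)).2

lemma singCoeff_mul {h m n : ℕ} (hmn : m.Coprime n) :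
    singCoeff h (m * n) = singCoeff h m * singCoeff h n := by
  unfold singCoeff
  simp only [Nat.coprime_mul_iff_left,
    ArithmeticFunction.isMultiplicative_moebius.map_mul_of_coprime hmn, Nat.totient_mul hmn]
  by_cases hm : m.Coprime h
  · by_cases hn : n.Coprime h
    · rw [if_pos ⟨hm, hn⟩, if_pos hm, if_pos hn]
      push_cast
      rw [mul_div_mul_comm]
    · rw [if_neg (fun H => hn H.2), if_neg hn, mul_zero]
  · rw [if_neg (fun H => hm H.1), if_neg hm, zero_mul]

/-- Comparison of the Dirichlet series of `singCoeff h` with the zeta function. -/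
lemma half_le_tsum_singCoeff_mul_tsum (h : ℕ) (heven : Even h) {s : ℝ} (hs : 0 < s) :
    1 / 2 ≤ (∑' n : ℕ, singCoeff h n * (n : ℝ) ^ (-s)) * ∑' n : ℕ, 1 / (n : ℝ) ^ (1 + s) := by
  have hF := EulerProduct.eulerProduct_hasProd (f := fun n : ℕ => singCoeff h n * (n : ℝ) ^ (-s))
    (by simp [singCoeff]) (by
      intro m n hmn
      simp only [Nat.cast_mul]
      rw [singCoeff_mul hmn, Real.mul_rpow (Nat.cast_nonneg m) (Nat.cast_nonneg n)]
      ring)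
    (summable_abs_singCoeff_mul_rpow h hs) (by simp [singCoeff])
  let g : ℕ →*₀ ℝ :=
    { toFun := fun n => 1 / (n : ℝ) ^ (1 + s)
      map_zero' := by simp [Real.zero_rpow (by positivity : 1 + s ≠ 0)]
      map_one' := by simp
      map_mul' := by
        intro m n
        rw [Nat.cast_mul, Real.mul_rpow (Nat.cast_nonneg m) (Nat.cast_nonneg n)]
        ring }
  have hgs : Summable fun n => ‖g n‖ :=
    (Real.summable_one_div_nat_rpow.2 (by linarith : 1 < 1 + s)).norm
  have hG := EulerProduct.eulerProduct_completely_multiplicative_hasProd (f := g) hgs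
  have hFG := hF.mul hG
  refine ge_of_tendsto' hFG fun S => (prod_primes_ge_half h heven S).trans ?_
  have hlocal : ∀ p : Nat.Primes, ∑' e : ℕ, singCoeff h ((p : ℕ) ^ e) *
      (((p : ℕ) ^ e : ℕ) : ℝ) ^ (-s) =
        1 + singCoeff h p * (p : ℝ) ^ (-s) := by
    intro p
    rw [tsum_eq_sum (s := Finset.range 2)]
    · simp [Finset.sum_range_succ, singCoeff]
    · intro e he
      have he2 : 2 ≤ e := by simpa [Nat.succ_le_iff] using he
      have : ArithmeticFunction.moebius ((p : ℕ) ^ e) = 0 := by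
        rw [ArithmeticFunction.moebius_apply_prime_pow p.2 (by omega), if_neg (by omega)]
      simp [singCoeff, this]
  refine Finset.prod_le_prod (fun p _ => ?_) fun p _ => ?_
  · have hp2 : (2 : ℝ) ≤ p := by exact_mod_cast p.2.two_le
    split_ifs
    · have : 1 / ((p : ℝ) - 1) ^ 2 ≤ 1 := by
        rw [div_le_one (by nlinarith)]; nlinarith
      linarith
    · norm_num
  · rw [hlocal p]
    have hp2 : (2 : ℝ) ≤ p := by exact_mod_cast p.2.two_le
    have hp0 : (0 : ℝ) < p := by linarith
    have hg : g (p : ℕ) = (p : ℝ) ^ (-s) / p := by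
      change 1 / ((p : ℕ) : ℝ) ^ (1 + s) = _
      rw [Real.rpow_add hp0, Real.rpow_one, Real.rpow_neg hp0.le]
      field_simp
    rw [hg]
    set x := (p : ℝ) ^ (-s)
    have hx0 : 0 < x := Real.rpow_pos_of_pos hp0 _
    have hx1 : x ≤ 1 := Real.rpow_le_one_of_one_le_of_nonpos (by linarith) (by linarith)
    have hxp : 0 < 1 - x / p := by
      rw [sub_pos, div_lt_one hp0]; linarith
    rw [← div_eq_mul_inv, le_div_iff₀ hxp]
    have hp1 : (0 : ℝ) < (p : ℝ) - 1 := by linarith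
    have hsc : singCoeff h p = if (p : ℕ).Coprime h then -(1 / ((p : ℝ) - 1)) else 0 := by
      unfold singCoeff
      rw [ArithmeticFunction.moebius_apply_prime p.2, Nat.totient_prime p.2,
        Nat.cast_sub p.2.one_le]
      split_ifs <;> simp [neg_div]
    rw [hsc]
    split_ifs
    · have key : 1 + -(1 / ((p : ℝ) - 1)) * x - (1 - 1 / ((p : ℝ) - 1) ^ 2) * (1 - x / p)
          = (1 - x) / ((p : ℝ) - 1) ^ 2 := by
        field_simp
        ring
      have : 0 ≤ (1 - x) / ((p : ℝ) - 1) ^ 2 := div_nonneg (by linarith) (by positivity)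
      linarith
    · have : 0 ≤ x / p := by positivity
      linarith

lemma eventually_quarter_mul_le_tsum_singCoeff (h : ℕ) (heven : Even h) :
    ∀ᶠ s : ℝ in nhdsWithin 0 (Set.Ioi 0),
      s / 4 ≤ ∑' n : ℕ, singCoeff h n * (n : ℝ) ^ (-s) := by
  have hshift : Tendsto (fun s : ℝ => 1 + s) (nhdsWithin 0 (Set.Ioi 0))
      (nhdsWithin 1 (Set.Ioi 1)) := by
    refine tendsto_nhdsWithin_iff.2 ⟨?_, ?_⟩
    · have : Tendsto (fun s : ℝ => 1 + s) (nhds 0) (nhds (1 + 0)) :=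
        tendsto_const_nhds.add tendsto_id
      rw [add_zero] at this
      exact this.mono_left nhdsWithin_le_nhds
    · filter_upwards [self_mem_nhdsWithin] with s hs
      simpa using hs
  have h1 := (tendsto_sub_mul_tsum_nat_rpow.comp hshift).eventually_lt_const
    (show (1 : ℝ) < 2 by norm_num)
  filter_upwards [h1, self_mem_nhdsWithin] with s hs hs0
  have hs0 : 0 < s := hs0
  have h2 := half_le_tsum_singCoeff_mul_tsum h heven hs0
  simp only [Function.comp_apply, add_sub_cancel_left] at hs
  set F := ∑' n : ℕ, singCoeff h n * (n : ℝ) ^ (-s)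
  set Z := ∑' n : ℕ, 1 / (n : ℝ) ^ (1 + s)
  have hZ : 0 ≤ Z := tsum_nonneg fun n => by positivity
  have hF : 0 ≤ F := by
    by_contra! hF
    nlinarith
  nlinarith

lemma integral_log_div_mul_rpow {c s : ℝ} (hc : 0 < c) (hs : 0 < s) :
    MeasureTheory.IntegrableOn (fun x : ℝ => Real.log (x / c) * x ^ (-1 - s)) (Set.Ioi c) ∧
      ∫ x in Set.Ioi c, Real.log (x / c) * x ^ (-1 - s) = c ^ (-s) / s ^ 2 := by
  set G : ℝ → ℝ := fun x => -(x ^ (-s) * (Real.log (x / c) / s + 1 / s ^ 2)) with hG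
  have hderiv : ∀ x : ℝ, 0 < x → HasDerivAt G (Real.log (x / c) * x ^ (-1 - s)) x := by
    intro x hx
    have h1 : HasDerivAt (fun x : ℝ => x ^ (-s)) (-s * x ^ (-s - 1)) x :=
      Real.hasDerivAt_rpow_const (Or.inl hx.ne')
    have h2 : HasDerivAt (fun x : ℝ => Real.log (x / c)) (1 / c / (x / c)) x :=
      ((hasDerivAt_id x).div_const c).log (by simp only [id]; positivity)
    have h3 := (h1.mul ((h2.div_const s).add_const (1 / s ^ 2))).neg
    refine h3.congr_deriv ?_
    rw [show -s - 1 = -1 - s by ring]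
    have h4 : x ^ (-s) = x ^ (-1 - s) * x := by
      rw [← Real.rpow_add_one hx.ne']; congr 1; ring
    rw [h4]
    field_simp
    ring
  have hcont : ContinuousWithinAt G (Set.Ici c) c :=
    (hderiv c hc).continuousAt.continuousWithinAt
  have hlim : Tendsto G atTop (nhds 0) := by
    have h1 : Tendsto (fun x : ℝ => x ^ (-s)) atTop (nhds 0) := tendsto_rpow_neg_atTop hs
    have h2 : Tendsto (fun x : ℝ => Real.log x / x ^ s) atTop (nhds 0) :=
      (isLittleO_log_rpow_atTop hs).tendsto_div_nhds_zero
    have h3 : Tendsto (fun x : ℝ => -((Real.log x / x ^ s) * (1 / s)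
        + x ^ (-s) * (-(Real.log c / s) + 1 / s ^ 2))) atTop (nhds 0) := by
      have h4 := ((h2.mul_const (1 / s)).add
        (h1.mul_const (-(Real.log c / s) + 1 / s ^ 2))).neg
      simpa only [zero_mul, add_zero, neg_zero] using h4
    refine h3.congr' ?_
    filter_upwards [eventually_gt_atTop 0] with x hx
    rw [hG]
    simp only
    rw [Real.log_div hx.ne' hc.ne', Real.rpow_neg hx.le]
    ring
  have hnn : ∀ x ∈ Set.Ioi c, 0 ≤ Real.log (x / c) * x ^ (-1 - s) := by
    intro x hx
    have hx : c < x := hx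
    refine mul_nonneg (Real.log_nonneg ?_) (Real.rpow_nonneg (by linarith) _)
    rw [le_div_iff₀ hc]; linarith
  have h_integrable := MeasureTheory.integrableOn_Ioi_deriv_of_nonneg hcont
    (fun x hx => hderiv x (hc.trans hx)) hnn hlim
  refine ⟨h_integrable, ?_⟩
  rw [MeasureTheory.integral_Ioi_of_hasDerivAt_of_tendsto hcont
    (fun x hx => hderiv x (hc.trans hx)) h_integrable hlim]
  simp [hG, div_self hc.ne']
  ring

lemma singCoeff_zero (h : ℕ) : singCoeff h 0 = 0 := by simp [singCoeff]

/-- Mellin transform of `singPartial h`. -/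
lemma hasSum_integral_singPartial (h : ℕ) {s : ℝ} (hs : 0 < s) :
    HasSum (fun n : ℕ => singCoeff h n * (n : ℝ) ^ (-s) / s ^ 2)
      (∫ x in Set.Ioi (1 : ℝ), singPartial h x * x ^ (-1 - s)) := by
  set F : ℕ → ℝ → ℝ := fun n => (Set.Ioi (n : ℝ)).indicator
    fun x => singCoeff h n * (Real.log (x / n) * x ^ (-1 - s)) with hF
  have hFint : ∀ n, MeasureTheory.Integrable (F n)
      (MeasureTheory.volume.restrict (Set.Ioi (1 : ℝ))) := by
    intro n
    rcases Nat.eq_zero_or_pos n with rfl | hn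
    · simp [hF, singCoeff_zero]
    have hn' : (0 : ℝ) < n := by exact_mod_cast hn
    refine MeasureTheory.Integrable.mono_measure ?_ MeasureTheory.Measure.restrict_le_self
    rw [MeasureTheory.integrable_indicator_iff measurableSet_Ioi]
    exact (integral_log_div_mul_rpow hn' hs).1.const_mul _
  have hcap : ∀ n : ℕ, 0 < n → Set.Ioi (1 : ℝ) ∩ Set.Ioi (n : ℝ) = Set.Ioi (n : ℝ) := by
    intro n hn
    refine Set.inter_eq_right.2 (Set.Ioi_subset_Ioi ?_)
    exact_mod_cast hn
  have hval : ∀ n, ∫ x in Set.Ioi (1 : ℝ), F n x = singCoeff h n * (n : ℝ) ^ (-s) / s ^ 2 := by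
    intro n
    rcases Nat.eq_zero_or_pos n with rfl | hn
    · simp [hF, singCoeff_zero]
    rw [hF, MeasureTheory.setIntegral_indicator measurableSet_Ioi, hcap n hn,
      MeasureTheory.integral_const_mul, (integral_log_div_mul_rpow (by exact_mod_cast hn) hs).2]
    ring
  have hnorm : ∀ n, ∫ x in Set.Ioi (1 : ℝ), ‖F n x‖
      = |singCoeff h n * (n : ℝ) ^ (-s)| / s ^ 2 := by
    intro n
    rcases Nat.eq_zero_or_pos n with rfl | hn
    · simp [hF, singCoeff_zero]
    have hn' : (0 : ℝ) < n := by exact_mod_cast hn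
    have h1 : (fun x => ‖F n x‖) = (Set.Ioi (n : ℝ)).indicator
        fun x => |singCoeff h n| * (Real.log (x / n) * x ^ (-1 - s)) := by
      funext x
      by_cases hx : x ∈ Set.Ioi (n : ℝ)
      · have hx' : (n : ℝ) < x := hx
        simp only [hF, Set.indicator_of_mem hx, norm_mul, Real.norm_eq_abs]
        rw [abs_of_nonneg (Real.log_nonneg ((one_le_div hn').2 hx'.le)),
          abs_of_nonneg (Real.rpow_nonneg (hn'.trans hx').le _)]
      · simp [hF, Set.indicator_of_notMem hx]
    rw [h1, MeasureTheory.setIntegral_indicator measurableSet_Ioi, hcap n hn,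
      MeasureTheory.integral_const_mul, (integral_log_div_mul_rpow hn' hs).2, abs_mul,
      abs_of_nonneg (Real.rpow_nonneg hn'.le _)]
    ring
  have key := MeasureTheory.hasSum_integral_of_summable_integral_norm hFint (by
    simp_rw [hnorm]
    exact (summable_abs_singCoeff_mul_rpow h hs).div_const _)
  simp_rw [hval] at key
  suffices hEq : ∫ x in Set.Ioi (1 : ℝ), singPartial h x * x ^ (-1 - s)
      = ∫ x in Set.Ioi (1 : ℝ), ∑' n, F n x by
    rw [hEq]
    exact key
  refine MeasureTheory.setIntegral_congr_fun measurableSet_Ioi fun x hx => ?_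
  have hx : (1 : ℝ) < x := hx
  rw [tsum_eq_sum (s := Finset.Icc 1 ⌊x⌋₊), singPartial, Finset.sum_mul]
  · refine Finset.sum_congr rfl fun d hd => ?_
    have hd2 : (d : ℝ) ≤ x := (Nat.le_floor_iff (by linarith)).1 (Finset.mem_Icc.1 hd).2
    have hd1 : (0 : ℝ) < d := by exact_mod_cast (Finset.mem_Icc.1 hd).1
    rcases hd2.lt_or_eq with h' | h'
    · simp only [hF]
      rw [Set.indicator_of_mem (show x ∈ Set.Ioi (d : ℝ) from h')]
      ring
    · simp [hF, ← h', div_self hd1.ne']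
  · intro n hn
    rcases Nat.eq_zero_or_pos n with rfl | hn0
    · simp [hF, singCoeff_zero]
    · refine Set.indicator_of_notMem (fun hx' => hn ?_) _
      exact Finset.mem_Icc.2 ⟨hn0, Nat.le_floor (le_of_lt hx')⟩

/-- `singPartial h` does not stay below `1/8`. -/
lemma exists_eighth_le_singPartial (h : ℕ) (heven : Even h) (X : ℝ) :
    ∃ x, X ≤ x ∧ 1 / 8 ≤ singPartial h x := by
  by_contra! hcon
  wlog hX : 1 ≤ X generalizing X
  · exact this 1 (fun x hx => hcon x (by linarith)) le_rfl
  set B := ∑ d ∈ Finset.Icc 1 ⌊X⌋₊, |singCoeff h d| * Real.log X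
  have hlogX : 0 ≤ Real.log X := Real.log_nonneg hX
  have hB : 0 ≤ B := Finset.sum_nonneg fun d _ => by positivity
  have hbound : ∀ x : ℝ, 1 < x → singPartial h x ≤ 1 / 8 + B * X * x ^ (-1 : ℝ) := by
    intro x hx
    have hx0 : 0 < x := by linarith
    rw [Real.rpow_neg_one]
    by_cases hxX : X ≤ x
    · have := hcon x hxX
      have h2 : 0 ≤ B * X * x⁻¹ := by positivity
      linarith
    · push Not at hxX
      have h1 : singPartial h x ≤ B := by
        refine (Finset.sum_le_sum (g := fun d => |singCoeff h d| * Real.log X)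
          fun d hd => ?_).trans (Finset.sum_le_sum_of_subset_of_nonneg
            (Finset.Icc_subset_Icc_right (Nat.floor_mono hxX.le)) fun d _ _ => by positivity)
        have hd2 : (d : ℝ) ≤ x := (Nat.le_floor_iff hx0.le).1 (Finset.mem_Icc.1 hd).2
        have hd1 : (1 : ℝ) ≤ d := by exact_mod_cast (Finset.mem_Icc.1 hd).1
        have hl0 : 0 ≤ Real.log (x / d) := Real.log_nonneg ((one_le_div (by linarith)).2 hd2)
        have hl1 : Real.log (x / d) ≤ Real.log X := by
          refine Real.log_le_log (by positivity) ?_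
          rw [div_le_iff₀ (by linarith)]; nlinarith
        exact (mul_le_mul_of_nonneg_right (le_abs_self _) hl0).trans
          (mul_le_mul_of_nonneg_left hl1 (abs_nonneg _))
      have h2 : B ≤ B * X * x⁻¹ := by
        rw [mul_assoc]
        refine le_mul_of_one_le_right hB ?_
        rw [← div_eq_mul_inv, one_le_div hx0]
        exact hxX.le
      linarith
  have hsmall : ∀ᶠ s : ℝ in nhdsWithin 0 (Set.Ioi 0), s < 1 / (8 * (B * X) + 8) :=
    nhdsWithin_le_nhds (eventually_lt_nhds (by positivity))
  obtain ⟨s, ⟨h1, h2⟩, h3⟩ := ((eventually_quarter_mul_le_tsum_singCoeff h heven).and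
    hsmall).and self_mem_nhdsWithin |>.exists
  have hs : 0 < s := h3
  have hsum := (hasSum_integral_singPartial h hs)
  have hval := hsum.tsum_eq
  rw [tsum_div_const] at hval
  have hle : ∫ x in Set.Ioi (1 : ℝ), singPartial h x * x ^ (-1 - s) ≤ 1 / (8 * s) + B * X := by
    have hi1 := integrableOn_Ioi_rpow_of_lt (show -1 - s < -1 by linarith) one_pos
    have hi2 := integrableOn_Ioi_rpow_of_lt (show -2 - s < -1 by linarith) one_pos
    have hgi := (hi1.const_mul (1 / 8)).add (hi2.const_mul (B * X))
    have hg : ∫ x in Set.Ioi (1 : ℝ), (1 / 8 * x ^ (-1 - s) + B * X * x ^ (-2 - s))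
        = 1 / (8 * s) + B * X * (1 / (1 + s)) := by
      rw [MeasureTheory.integral_add (hi1.const_mul _) (hi2.const_mul _),
        MeasureTheory.integral_const_mul, MeasureTheory.integral_const_mul,
        integral_Ioi_rpow_of_lt (by linarith) one_pos,
        integral_Ioi_rpow_of_lt (by linarith) one_pos, Real.one_rpow, Real.one_rpow]
      rw [show -1 - s + 1 = -s by ring, show -2 - s + 1 = -(1 + s) by ring, neg_div_neg_eq,
        neg_div_neg_eq]
      field_simp
    have hBX : B * X * (1 / (1 + s)) ≤ B * X := by
      refine mul_le_of_le_one_right (by positivity) ?_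
      rw [div_le_one (by linarith)]; linarith
    refine le_trans ?_ (hg.le.trans (by linarith))
    by_cases hfi : MeasureTheory.IntegrableOn (fun x => singPartial h x * x ^ (-1 - s))
        (Set.Ioi (1 : ℝ))
    · refine MeasureTheory.setIntegral_mono_on hfi hgi measurableSet_Ioi fun x hx => ?_
      have hx : (1 : ℝ) < x := hx
      have := mul_le_mul_of_nonneg_right (hbound x hx)
        (Real.rpow_nonneg (show 0 ≤ x by linarith) (-1 - s))
      refine this.trans (le_of_eq ?_)
      rw [add_mul, mul_assoc (B * X), ← Real.rpow_add (by linarith)]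
      congr 3
      ring
    · rw [MeasureTheory.integral_undef hfi, hg]
      positivity
  rw [← hval, div_le_iff₀ (by positivity)] at hle
  have h4 : (1 / (8 * s) + B * X) * s ^ 2 = s / 8 + B * X * s * s := by
    field_simp
  rw [h4] at hle
  rw [lt_div_iff₀ (by positivity)] at h2
  nlinarith [mul_pos hs hs]

lemma abs_sum_mod_le_maxAbs (f : ℕ → ℝ) (q N a : ℕ) :
    |∑ n ∈ Finset.Icc 1 N, if n % q = a % q then f n else 0| ≤ maxAbs f q N := by
  refine le_ciSup (f := fun a : ℕ => |∑ n ∈ Finset.Icc 1 N, if n % q = a % q then f n else 0|)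
    ⟨∑ n ∈ Finset.Icc 1 N, |f n|, ?_⟩ a
  rintro _ ⟨b, rfl⟩
  refine (Finset.abs_sum_le_sum_abs _ _).trans (Finset.sum_le_sum fun n _ => ?_)
  split_ifs <;> simp

lemma maxAbs_nonneg (f : ℕ → ℝ) (q N : ℕ) : 0 ≤ maxAbs f q N :=
  (abs_nonneg _).trans (abs_sum_mod_le_maxAbs f q N 0)

lemma abs_sum_prime_mod_sub_le {q a : ℕ} (N : ℕ) (ha : a.Coprime q) :
    |(∑ p ∈ Finset.Icc 1 N, if p.Prime ∧ p % q = a % q then Real.log p else 0)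
      - N / q.totient| ≤ primeMaxAbs q N := by
  have hb : BddAbove (Set.range fun a : ℕ => if Nat.Coprime a q then
      |(∑ p ∈ Finset.Icc 1 N, if p.Prime ∧ p % q = a % q then Real.log p else 0)
        - N / q.totient| else 0) := by
    refine ⟨∑ n ∈ Finset.Icc 1 N, |Real.log n| + |(N : ℝ) / q.totient|, ?_⟩
    rintro _ ⟨b, rfl⟩
    dsimp only
    split_ifs
    · refine (abs_sub _ _).trans (add_le_add_left ?_ _)
      refine (Finset.abs_sum_le_sum_abs _ _).trans (Finset.sum_le_sum fun n _ => ?_)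
      split_ifs <;> simp
    · positivity
  refine le_trans (le_of_eq ?_) (le_ciSup hb a)
  simp only [if_pos ha]

lemma primeMaxAbs_nonneg (q N : ℕ) : 0 ≤ primeMaxAbs q N :=
  (abs_nonneg _).trans (abs_sum_prime_mod_sub_le N (Nat.coprime_one_left q))

lemma dvd_add_iff_mod_eq {d : ℕ} (hd : 0 < d) (n h : ℕ) :
    d ∣ n + h ↔ n % d = h * (d - 1) % d := by
  have h1 : h * (d - 1) + h = h * d := by
    obtain ⟨c, rfl⟩ := Nat.exists_eq_add_of_le' hd
    simp; ring
  constructor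
  · intro H
    have : n + h ≡ h * (d - 1) + h [MOD d] := by
      rw [h1]
      exact ((Nat.modEq_zero_iff_dvd.2 H)).trans
        (Nat.modEq_zero_iff_dvd.2 (dvd_mul_left d h)).symm
    exact Nat.ModEq.add_right_cancel' h this
  · intro H
    have : n + h ≡ h * (d - 1) + h [MOD d] := Nat.ModEq.add_right h H
    rw [h1] at this
    exact Nat.modEq_zero_iff_dvd.1 (this.trans (Nat.modEq_zero_iff_dvd.2 (dvd_mul_left d h)))

lemma coprime_mul_pred {d h : ℕ} (hd : 0 < d) (hdh : d.Coprime h) :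
    (h * (d - 1)).Coprime d := by
  refine Nat.Coprime.mul_left hdh.symm ?_
  obtain ⟨c, rfl⟩ := Nat.exists_eq_add_of_le' hd
  simp

lemma abs_sum_dvd_le_maxAbs (f : ℕ → ℝ) {q : ℕ} (hq : 0 < q) (N h : ℕ) :
    |∑ n ∈ Finset.Icc 1 N, if q ∣ n + h then f n else 0| ≤ maxAbs f q N := by
  simp only [dvd_add_iff_mod_eq hq]
  exact abs_sum_mod_le_maxAbs f q N _

lemma theta_nonneg (n : ℕ) : 0 ≤ theta n := by
  unfold theta
  split_ifs
  · exact Real.log_natCast_nonneg n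
  · exact le_rfl

lemma theta_le_log (n : ℕ) : theta n ≤ Real.log n := by
  unfold theta
  split_ifs
  · exact le_rfl
  · exact Real.log_natCast_nonneg n

/-- The weighted count of primes `n ≤ N` with `d ∣ n + h`. -/
noncomputable def shiftedTheta (h N d : ℕ) : ℝ :=
  ∑ n ∈ Finset.Icc 1 N, if d ∣ n + h then theta n else 0

lemma abs_shiftedTheta_sub_le {h d : ℕ} (N : ℕ) (hd : 0 < d) (hdh : d.Coprime h) :
    |shiftedTheta h N d - N / d.totient| ≤ primeMaxAbs d N := by
  have := abs_sum_prime_mod_sub_le N (coprime_mul_pred hd hdh)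
  convert this using 4
  unfold shiftedTheta
  refine Finset.sum_congr rfl fun n _ => ?_
  simp only [dvd_add_iff_mod_eq hd, theta]
  by_cases h1 : n.Prime <;> by_cases h2 : n % d = h * (d - 1) % d <;> simp [h1, h2]

lemma shiftedTheta_nonneg (h N d : ℕ) : 0 ≤ shiftedTheta h N d :=
  Finset.sum_nonneg fun n _ => by split_ifs <;> simp [theta_nonneg]

lemma shiftedTheta_le_of_not_coprime {h d : ℕ} (N : ℕ) (hpos : 0 < h) (hdh : ¬ d.Coprime h) :
    shiftedTheta h N d ≤ h * Real.log h := by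
  have hterm : ∀ n ∈ Finset.Icc 1 N, (if d ∣ n + h then theta n else 0)
      ≤ if n ∈ Finset.Icc 1 h then Real.log h else 0 := by
    intro n hn
    have h0 : (0 : ℝ) ≤ if n ∈ Finset.Icc 1 h then Real.log h else 0 := by
      split_ifs
      · exact Real.log_natCast_nonneg h
      · exact le_rfl
    by_cases hdn : d ∣ n + h
    · by_cases hp : n.Prime
      · have hg : d.gcd h ∣ n :=
          (Nat.dvd_add_left (Nat.gcd_dvd_right d h)).1 ((Nat.gcd_dvd_left d h).trans hdn)
        have hgn : d.gcd h = n := (hp.eq_one_or_self_of_dvd _ hg).resolve_left hdh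
        have hnh : n ≤ h := hgn ▸ Nat.gcd_le_right d hpos
        have hn1 := (Finset.mem_Icc.1 hn).1
        rw [if_pos hdn, if_pos (Finset.mem_Icc.2 ⟨hn1, hnh⟩)]
        refine (theta_le_log n).trans (Real.log_le_log ?_ ?_)
        · exact_mod_cast hn1
        · exact_mod_cast hnh
      · simpa [theta, hp] using h0
    · rwa [if_neg hdn]
  refine (Finset.sum_le_sum hterm).trans ?_
  rw [← Finset.sum_filter, Finset.sum_const, nsmul_eq_mul]
  refine mul_le_mul_of_nonneg_right ?_ (Real.log_natCast_nonneg h)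
  have : ((Finset.Icc 1 N).filter fun n => n ∈ Finset.Icc 1 h).card ≤ (Finset.Icc 1 h).card :=
    Finset.card_le_card fun n hn => (Finset.mem_filter.1 hn).2
  rw [Nat.card_Icc, Nat.add_sub_cancel] at this
  exact_mod_cast this

/-- The short divisors contribute the truncated singular series up to level-of-distribution
errors. -/
lemma short_divisor_sum_ge (h N : ℕ) (hpos : 0 < h) {D : ℝ} (hD : 1 ≤ D) :
    N * singPartial h D - Real.log D *
        (∑ d ∈ Finset.Icc 1 ⌊D⌋₊, primeMaxAbs d N + D * (h * Real.log h))
      ≤ ∑ d ∈ Finset.Icc 1 ⌊D⌋₊,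
        (ArithmeticFunction.moebius d : ℝ) * Real.log (D / d) * shiftedTheta h N d := by
  have hlD : 0 ≤ Real.log D := Real.log_nonneg hD
  have hc : 0 ≤ h * Real.log h := mul_nonneg (Nat.cast_nonneg h) (Real.log_natCast_nonneg h)
  have hterm : ∀ d ∈ Finset.Icc 1 ⌊D⌋₊,
      N * (singCoeff h d * Real.log (D / d)) - Real.log D * (primeMaxAbs d N + h * Real.log h)
        ≤ (ArithmeticFunction.moebius d : ℝ) * Real.log (D / d) * shiftedTheta h N d := by
    intro d hd
    have hd0 : 0 < d := (Finset.mem_Icc.1 hd).1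
    have hd1 : (1 : ℝ) ≤ d := by exact_mod_cast hd0
    have hd2 : (d : ℝ) ≤ D := (Nat.le_floor_iff (by linarith)).1 (Finset.mem_Icc.1 hd).2
    have hl0 : 0 ≤ Real.log (D / d) := Real.log_nonneg ((one_le_div (by linarith)).2 hd2)
    have hl1 : Real.log (D / d) ≤ Real.log D := by
      refine Real.log_le_log (by positivity) (div_le_self (by linarith) hd1)
    have hμ := abs_moebius_le_one_real d
    set m := (ArithmeticFunction.moebius d : ℝ)
    have hP := primeMaxAbs_nonneg d N
    have gen : ∀ E B : ℝ, |E| ≤ B → -(Real.log D * B) ≤ m * Real.log (D / d) * E := by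
      intro E B hE
      have hB : 0 ≤ B := (abs_nonneg _).trans hE
      have h3 : |m * Real.log (D / d) * E| ≤ Real.log D * B := by
        rw [abs_mul, abs_mul, abs_of_nonneg hl0]
        have : |m| * Real.log (D / d) ≤ Real.log D := by nlinarith
        exact mul_le_mul this hE (abs_nonneg _) hlD
      exact (abs_le.1 h3).1
    by_cases hdh : d.Coprime h
    · have h4 := gen _ _ (abs_shiftedTheta_sub_le N hd0 hdh)
      have h5 : singCoeff h d = m / d.totient := by simp [singCoeff, hdh, m]
      rw [h5]
      have h6 : N * (m / d.totient * Real.log (D / d))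
          = m * Real.log (D / d) * (N / d.totient) := by ring
      rw [h6]
      nlinarith [mul_nonneg hlD hc]
    · have h4 := gen (shiftedTheta h N d) (h * Real.log h) (by
        rw [abs_of_nonneg (shiftedTheta_nonneg h N d)]
        exact shiftedTheta_le_of_not_coprime N hpos hdh)
      have h5 : singCoeff h d = 0 := by simp [singCoeff, hdh]
      rw [h5]
      nlinarith [mul_nonneg hlD hP]
  refine le_trans ?_ (Finset.sum_le_sum hterm)
  rw [Finset.sum_sub_distrib, ← Finset.mul_sum, ← Finset.mul_sum, Finset.sum_add_distrib,
    singPartial]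
  have : ∑ d ∈ Finset.Icc 1 ⌊D⌋₊, h * Real.log h ≤ D * (h * Real.log h) := by
    rw [Finset.sum_const, nsmul_eq_mul, Nat.card_Icc, Nat.add_sub_cancel]
    exact mul_le_mul_of_nonneg_right (Nat.floor_le (by linarith)) hc
  nlinarith

lemma sum_divisors_moebius_real {m : ℕ} :
    ∑ d ∈ m.divisors, (ArithmeticFunction.moebius d : ℝ) = if m = 1 then 1 else 0 := by
  have := ArithmeticFunction.coe_mul_zeta_apply (f := ArithmeticFunction.moebius) (x := m)
  rw [ArithmeticFunction.moebius_mul_coe_zeta, ArithmeticFunction.one_apply] at this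
  exact_mod_cast this.symm

lemma vonMangoldt_eq_sub_posLog {m : ℕ} (hm : 1 < m) {D : ℝ} (hD : 0 < D) :
    ArithmeticFunction.vonMangoldt m =
      ∑ d ∈ m.divisors, (ArithmeticFunction.moebius d : ℝ) * Real.posLog (D / d)
      - ∑ d ∈ m.divisors, (ArithmeticFunction.moebius d : ℝ) * Real.posLog (d / D) := by
  rw [← Finset.sum_sub_distrib]
  have h1 : ∀ d ∈ m.divisors, (ArithmeticFunction.moebius d : ℝ) * Real.posLog (D / d)
      - (ArithmeticFunction.moebius d : ℝ) * Real.posLog (d / D)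
      = Real.log D * ArithmeticFunction.moebius d
        - (ArithmeticFunction.moebius d : ℝ) * Real.log d := by
    intro d hd
    have hd0 : (d : ℝ) ≠ 0 := by exact_mod_cast (Nat.pos_of_mem_divisors hd).ne'
    rw [← mul_sub, ← inv_div D, Real.posLog_sub_posLog_inv, Real.log_div hD.ne' hd0]
    ring
  rw [Finset.sum_congr rfl h1, Finset.sum_sub_distrib, ← Finset.mul_sum,
    sum_divisors_moebius_real, if_neg hm.ne']
  have h2 : ∑ d ∈ m.divisors, (ArithmeticFunction.moebius d : ℝ) * Real.log d
      = -ArithmeticFunction.vonMangoldt m := by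
    simpa [ArithmeticFunction.log_apply] using
      ArithmeticFunction.sum_moebius_mul_log_eq (n := m)
  rw [h2]
  ring

lemma sum_divisors_posLog_eq {m : ℕ} (hm : 0 < m) {D : ℝ} (hD : 0 < D) :
    ∑ d ∈ m.divisors, (ArithmeticFunction.moebius d : ℝ) * Real.posLog (D / d)
      = ∑ d ∈ Finset.Icc 1 ⌊D⌋₊,
        if d ∣ m then (ArithmeticFunction.moebius d : ℝ) * Real.log (D / d) else 0 := by
  rw [← Finset.sum_filter]
  have hsub : ((Finset.Icc 1 ⌊D⌋₊).filter fun d => d ∣ m) ⊆ m.divisors := fun d hd =>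
    Nat.mem_divisors.2 ⟨(Finset.mem_filter.1 hd).2, hm.ne'⟩
  rw [← Finset.sum_subset hsub]
  · refine Finset.sum_congr rfl fun d hd => ?_
    have hd' := Finset.mem_Icc.1 (Finset.mem_filter.1 hd).1
    have hd1 : (0 : ℝ) < d := by exact_mod_cast hd'.1
    have hd2 : (d : ℝ) ≤ D := (Nat.le_floor_iff hD.le).1 hd'.2
    rw [Real.posLog_eq_log]
    exact ((one_le_div hd1).2 hd2).trans (le_abs_self _)
  · intro d hd hd'
    have hd0 := Nat.pos_of_mem_divisors hd
    have hd1 : (0 : ℝ) < d := by exact_mod_cast hd0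
    have : D < d := by
      by_contra! H
      exact hd' (Finset.mem_filter.2 ⟨Finset.mem_Icc.2 ⟨hd0, Nat.le_floor H⟩,
        Nat.dvd_of_mem_divisors hd⟩)
    rw [(Real.posLog_eq_zero_iff _).2, mul_zero]
    rw [abs_of_pos (by positivity), div_le_one hd1]
    exact this.le

lemma sq_dvd_sq_mul_iff {a b k : ℕ} (ha : Squarefree a) : k ^ 2 ∣ b ^ 2 * a ↔ k ∣ b := by
  constructor
  · intro H
    rcases Nat.eq_zero_or_pos (k.gcd b) with h0 | hg
    · obtain ⟨-, rfl⟩ := Nat.gcd_eq_zero_iff.1 h0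
      exact dvd_zero _
    obtain ⟨k', b', hcop, hk, hb⟩ := Nat.exists_coprime k b
    set g := k.gcd b
    have h1 : k' ^ 2 ∣ b' ^ 2 * a := by
      have h2 : g ^ 2 * k' ^ 2 ∣ g ^ 2 * (b' ^ 2 * a) := by
        convert H using 1
        · rw [hk]; ring
        · rw [hb]; ring
      exact Nat.dvd_of_mul_dvd_mul_left (by positivity) h2
    have h3 : k' ^ 2 ∣ a := (Nat.Coprime.pow 2 2 hcop).dvd_of_dvd_mul_left h1
    have h4 : IsUnit k' := ha k' (by rwa [← sq])
    rw [Nat.isUnit_iff.1 h4, one_mul] at hk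
    rw [hk]
    exact Nat.gcd_dvd_right k b
  · intro H
    exact (pow_dvd_pow_of_dvd H 2).mul_right a

lemma sum_sq_dvd_moebius {d Z : ℕ} (hd : 0 < d) (hdZ : d ≤ Z) :
    ∑ k ∈ Finset.Icc 1 Z, (if k ^ 2 ∣ d then (ArithmeticFunction.moebius k : ℝ) else 0)
      = if Squarefree d then 1 else 0 := by
  obtain ⟨a, b, rfl, ha⟩ := Nat.sq_mul_squarefree d
  have hb : b ≠ 0 := by rintro rfl; simp at hd
  have ha0 : a ≠ 0 := by rintro rfl; simp at hd
  rw [← Finset.sum_filter]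
  have hset : ((Finset.Icc 1 Z).filter fun k => k ^ 2 ∣ b ^ 2 * a) = b.divisors := by
    ext k
    rw [Finset.mem_filter, sq_dvd_sq_mul_iff ha, Nat.mem_divisors, Finset.mem_Icc]
    constructor
    · rintro ⟨-, h⟩
      exact ⟨h, hb⟩
    · rintro ⟨h, -⟩
      refine ⟨⟨Nat.pos_of_dvd_of_pos h (Nat.pos_of_ne_zero hb), ?_⟩, h⟩
      calc k ≤ b := Nat.le_of_dvd (Nat.pos_of_ne_zero hb) h
        _ ≤ b ^ 2 * a := by
          have : 1 ≤ a := Nat.pos_of_ne_zero ha0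
          nlinarith [Nat.le_self_pow (two_ne_zero) b]
        _ ≤ Z := hdZ
  rw [hset, sum_divisors_moebius_real]
  congr 1
  refine propext ⟨fun h => by simpa [h] using ha, fun h => ?_⟩
  exact Nat.isUnit_iff.1 (h b (by rw [← sq]; exact dvd_mul_right _ _))

lemma lio_mul {m n : ℕ} (hm : m ≠ 0) (hn : n ≠ 0) : lio (m * n) = lio m * lio n := by
  unfold lio
  rw [(Nat.perm_primeFactorsList_mul hm hn).length_eq, List.length_append, pow_add]

lemma lio_mul_self (n : ℕ) : lio n * lio n = 1 := by
  unfold lio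
  rw [← mul_pow]
  norm_num

lemma abs_lio (n : ℕ) : |lio n| = 1 := by
  simp [lio]

lemma moebius_eq_lio_mul {d : ℕ} :
    (ArithmeticFunction.moebius d : ℝ) = lio d * if Squarefree d then 1 else 0 := by
  split_ifs with h
  · rw [ArithmeticFunction.moebius_apply_of_squarefree h, ArithmeticFunction.cardFactors_apply, lio]
    simp
  · simp [ArithmeticFunction.moebius_eq_zero_of_not_squarefree h]

/-- The Möbius function at a codivisor, expressed through the Liouville function. -/
lemma moebius_div_eq {m e Z : ℕ} (hm : 0 < m) (hmZ : m ≤ Z) (he : e ∣ m) :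
    (ArithmeticFunction.moebius (m / e) : ℝ) = lio m * lio e *
      ∑ k ∈ Finset.Icc 1 Z, if e * k ^ 2 ∣ m then (ArithmeticFunction.moebius k : ℝ) else 0 := by
  obtain ⟨d, rfl⟩ := he
  have he0 : 0 < e := Nat.pos_of_mul_pos_right hm
  have hd0 : 0 < d := Nat.pos_of_mul_pos_left hm
  rw [Nat.mul_div_cancel_left d he0, moebius_eq_lio_mul,
    ← sum_sq_dvd_moebius hd0 ((Nat.le_mul_of_pos_left d he0).trans hmZ), lio_mul he0.ne' hd0.ne']
  simp only [Nat.mul_dvd_mul_iff_left he0]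
  have := lio_mul_self e
  linear_combination (-(lio d * ∑ k ∈ Finset.Icc 1 Z,
    if k ^ 2 ∣ d then (ArithmeticFunction.moebius k : ℝ) else 0)) * this

/-- The correlation sum attached to the complementary divisor `e` and the square `k ^ 2`. -/
noncomputable def longDivisorSum (h N : ℕ) (D : ℝ) (k e : ℕ) : ℝ :=
  ∑ n ∈ Finset.Icc 1 N, if e * k ^ 2 ∣ n + h then
    theta n * lio (n + h) * Real.posLog (((n + h : ℕ) : ℝ) / (e * D)) else 0

lemma sum_divisors_moebius_posLog_eq {m Z : ℕ} (hm : 0 < m) (hmZ : m ≤ Z) (D : ℝ) :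
    ∑ d ∈ m.divisors, (ArithmeticFunction.moebius d : ℝ) * Real.posLog (d / D)
      = ∑ k ∈ Finset.Icc 1 Z, ∑ e ∈ Finset.Icc 1 Z, ArithmeticFunction.moebius k * lio e *
        if e * k ^ 2 ∣ m then lio m * Real.posLog ((m : ℝ) / (e * D)) else 0 := by
  rw [← Nat.sum_div_divisors]
  have h1 : ∀ e ∈ m.divisors, (ArithmeticFunction.moebius (m / e) : ℝ) *
      Real.posLog (((m / e : ℕ) : ℝ) / D) = ∑ k ∈ Finset.Icc 1 Z,
        ArithmeticFunction.moebius k * lio e *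
        if e * k ^ 2 ∣ m then lio m * Real.posLog ((m : ℝ) / (e * D)) else 0 := by
    intro e he
    have he0 : (e : ℝ) ≠ 0 := by exact_mod_cast (Nat.pos_of_mem_divisors he).ne'
    rw [moebius_div_eq hm hmZ (Nat.dvd_of_mem_divisors he),
      Nat.cast_div (Nat.dvd_of_mem_divisors he) he0, div_div, Finset.mul_sum, Finset.sum_mul]
    refine Finset.sum_congr rfl fun k _ => ?_
    split_ifs <;> ring
  rw [Finset.sum_congr rfl h1, Finset.sum_comm]
  refine Finset.sum_congr rfl fun k _ => ?_
  refine Finset.sum_subset ?_ ?_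
  · intro e he
    exact Finset.mem_Icc.2 ⟨Nat.pos_of_mem_divisors he, (Nat.divisor_le he).trans hmZ⟩
  · intro e _ he
    have : ¬ e * k ^ 2 ∣ m := fun H =>
      he (Nat.mem_divisors.2 ⟨(dvd_mul_right e _).trans H, hm.ne'⟩)
    simp [this]

/-- Decomposition of the prime pair sum into short divisors and complementary divisors. -/
lemma sum_theta_mul_vonMangoldt_ge (h N : ℕ) (hpos : 0 < h) {D : ℝ} (hD : 0 < D) :
    (∑ d ∈ Finset.Icc 1 ⌊D⌋₊,
        (ArithmeticFunction.moebius d : ℝ) * Real.log (D / d) * shiftedTheta h N d)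
      - ∑ k ∈ Finset.Icc 1 (N + h), ∑ e ∈ Finset.Icc 1 (N + h), |longDivisorSum h N D k e|
      ≤ ∑ n ∈ Finset.Icc 1 N, theta n * ArithmeticFunction.vonMangoldt (n + h) := by
  have h1 : ∀ n ∈ Finset.Icc 1 N, theta n * ArithmeticFunction.vonMangoldt (n + h)
      = (∑ d ∈ Finset.Icc 1 ⌊D⌋₊, (ArithmeticFunction.moebius d : ℝ) * Real.log (D / d) *
          if d ∣ n + h then theta n else 0)
        - ∑ k ∈ Finset.Icc 1 (N + h), ∑ e ∈ Finset.Icc 1 (N + h),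
          ArithmeticFunction.moebius k * lio e * if e * k ^ 2 ∣ n + h then
            theta n * lio (n + h) * Real.posLog (((n + h : ℕ) : ℝ) / (e * D)) else 0 := by
    intro n hn
    have hn' := Finset.mem_Icc.1 hn
    rw [vonMangoldt_eq_sub_posLog (by omega) hD, sum_divisors_posLog_eq (by omega) hD,
      sum_divisors_moebius_posLog_eq (Z := N + h) (by omega) (by omega), mul_sub, Finset.mul_sum,
      Finset.mul_sum]
    congr 1
    · refine Finset.sum_congr rfl fun d _ => ?_
      split_ifs <;> ring
    · refine Finset.sum_congr rfl fun k _ => ?_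
      rw [Finset.mul_sum]
      refine Finset.sum_congr rfl fun e _ => ?_
      split_ifs <;> ring
  rw [Finset.sum_congr rfl h1, Finset.sum_sub_distrib]
  refine sub_le_sub (le_of_eq ?_) ?_
  · rw [Finset.sum_comm]
    refine Finset.sum_congr rfl fun d _ => ?_
    rw [shiftedTheta, Finset.mul_sum]
  · rw [Finset.sum_comm]
    refine Finset.sum_le_sum fun k _ => ?_
    rw [Finset.sum_comm]
    refine Finset.sum_le_sum fun e _ => ?_
    rw [← Finset.mul_sum]
    refine (le_abs_self _).trans ?_
    rw [abs_mul, abs_mul, abs_lio, mul_one]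
    exact mul_le_of_le_one_left (abs_nonneg _) (abs_moebius_le_one_real k)

/-- Abel summation bound against a nonnegative monotone weight. -/
lemma abs_sum_mul_le_of_partial_sums {b g M : ℕ → ℝ} (hg : Monotone g) (hg0 : ∀ n, 0 ≤ g n)
    (hM : ∀ t, |∑ n ∈ Finset.Icc 1 t, b n| ≤ M t) (N : ℕ) :
    |∑ n ∈ Finset.Icc 1 N, b n * g n|
      ≤ M N * g N + ∑ t ∈ Finset.Ico 1 N, M t * (g (t + 1) - g t) := by
  have key : ∑ n ∈ Finset.Icc 1 N, b n * g n = (∑ n ∈ Finset.Icc 1 N, b n) * g N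
      - ∑ t ∈ Finset.Ico 1 N, (∑ n ∈ Finset.Icc 1 t, b n) * (g (t + 1) - g t) := by
    induction N with
    | zero => simp
    | succ N ih =>
      rw [Finset.sum_Icc_succ_top (by omega), Finset.sum_Icc_succ_top (by omega), ih]
      rcases Nat.eq_zero_or_pos N with rfl | hN
      · simp
      · rw [Finset.sum_Ico_succ_top hN]
        ring
  rw [key]
  refine (abs_sub _ _).trans (add_le_add ?_ ?_)
  · rw [abs_mul, abs_of_nonneg (hg0 N)]
    exact mul_le_mul_of_nonneg_right (hM N) (hg0 N)
  · refine (Finset.abs_sum_le_sum_abs _ _).trans (Finset.sum_le_sum fun t _ => ?_)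
    have h1 : 0 ≤ g (t + 1) - g t := sub_nonneg.2 (hg (Nat.le_succ t))
    rw [abs_mul, abs_of_nonneg h1]
    exact mul_le_mul_of_nonneg_right (hM t) h1

/-- The logarithmic weight occurring in `longDivisorSum`. -/
noncomputable def longWeight (h : ℕ) (D : ℝ) (e t : ℕ) : ℝ :=
  Real.posLog (((t + h : ℕ) : ℝ) / (e * D))

lemma longWeight_nonneg (h : ℕ) (D : ℝ) (e t : ℕ) : 0 ≤ longWeight h D e t :=
  Real.posLog_nonneg

lemma longWeight_mono (h : ℕ) {D : ℝ} (hD : 0 ≤ D) (e : ℕ) : Monotone (longWeight h D e) := by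
  intro s t hst
  refine Real.posLog_le_posLog (by positivity) ?_
  have : ((s + h : ℕ) : ℝ) ≤ ((t + h : ℕ) : ℝ) := by exact_mod_cast Nat.add_le_add_right hst h
  gcongr

lemma longWeight_le_log (h : ℕ) {D : ℝ} (hD : 1 ≤ D) {e t : ℕ} (he : 0 < e) (ht : 0 < t) :
    longWeight h D e t ≤ Real.log ((t + h : ℕ) : ℝ) := by
  have h1 : (1 : ℝ) ≤ ((t + h : ℕ) : ℝ) := by exact_mod_cast (by omega : 1 ≤ t + h)
  have he1 : (1 : ℝ) ≤ e := by exact_mod_cast he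
  rw [← Real.posLog_eq_log (h1.trans (le_abs_self _))]
  refine Real.posLog_le_posLog (by positivity) (div_le_self (by positivity) ?_)
  nlinarith

lemma longWeight_eq_zero {h : ℕ} {D : ℝ} {e t : ℕ} (H : ((t + h : ℕ) : ℝ) ≤ e * D) :
    longWeight h D e t = 0 := by
  have h0 : (0 : ℝ) ≤ ((t + h : ℕ) : ℝ) := by positivity
  rw [longWeight, Real.posLog_eq_zero_iff, abs_of_nonneg (div_nonneg h0 (h0.trans H))]
  exact div_le_one_of_le₀ H (h0.trans H)

lemma longWeight_succ_sub_le (h : ℕ) {D : ℝ} (hD : 0 < D) {e t : ℕ} (ht : 0 < t) :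
    longWeight h D e (t + 1) - longWeight h D e t ≤ 1 / t := by
  have ht0 : (0 : ℝ) < t := by exact_mod_cast ht
  have hth : (0 : ℝ) < ((t + h : ℕ) : ℝ) := by exact_mod_cast (by omega : 0 < t + h)
  have h1 : (((t + 1 + h : ℕ) : ℝ) / (e * D))
      = (1 + 1 / ((t + h : ℕ) : ℝ)) * (((t + h : ℕ) : ℝ) / (e * D)) := by
    have : ((t + 1 + h : ℕ) : ℝ) = (1 + 1 / ((t + h : ℕ) : ℝ)) * ((t + h : ℕ) : ℝ) := by
      field_simp
      push_cast
      ring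
    rw [this, mul_div_assoc]
  have h2 := Real.posLog_mul (x := 1 + 1 / ((t + h : ℕ) : ℝ)) (y := ((t + h : ℕ) : ℝ) / (e * D))
  have h3 : Real.posLog (1 + 1 / ((t + h : ℕ) : ℝ)) ≤ 1 / t := by
    have h4 : (0 : ℝ) < 1 / ((t + h : ℕ) : ℝ) := by positivity
    rw [Real.posLog_eq_log (by rw [abs_of_pos] <;> linarith)]
    refine (Real.log_le_sub_one_of_pos (by linarith)).trans ?_
    rw [add_sub_cancel_left]
    refine one_div_le_one_div_of_le ht0 ?_
    exact_mod_cast Nat.le_add_right t h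
  unfold longWeight
  rw [h1]
  linarith

lemma abs_longDivisorSum_le_maxAbs (h N : ℕ) {D : ℝ} (hD : 0 ≤ D) {k e : ℕ} (hk : 0 < k)
    (he : 0 < e) :
    |longDivisorSum h N D k e|
      ≤ maxAbs (fun n => theta n * lio (n + h)) (e * k ^ 2) N * longWeight h D e N
        + ∑ t ∈ Finset.Ico 1 N, maxAbs (fun n => theta n * lio (n + h)) (e * k ^ 2) t
          * (longWeight h D e (t + 1) - longWeight h D e t) := by
  have := abs_sum_mul_le_of_partial_sums
    (b := fun n => if e * k ^ 2 ∣ n + h then theta n * lio (n + h) else 0)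
    (longWeight_mono h hD e) (longWeight_nonneg h D e)
    (fun t => abs_sum_dvd_le_maxAbs (fun n => theta n * lio (n + h))
      (by positivity : 0 < e * k ^ 2) t h) N
  refine le_trans (le_of_eq ?_) this
  unfold longDivisorSum longWeight
  congr 1
  refine Finset.sum_congr rfl fun n _ => ?_
  split_ifs <;> simp

lemma card_filter_dvd_add_le (h N q : ℕ) :
    (((Finset.Icc 1 N).filter fun n => q ∣ n + h).card : ℝ) ≤ ((N + h : ℕ) : ℝ) / q := by
  have h1 : ((Finset.Icc 1 N).filter fun n => q ∣ n + h).card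
      ≤ ((Finset.Ioc 0 (N + h)).filter fun n => q ∣ n).card := by
    refine Finset.card_le_card_of_injOn (fun n => n + h) ?_ ?_
    · intro n hn
      have hn' := Finset.mem_filter.1 (Finset.mem_coe.1 hn)
      have hn1 := Finset.mem_Icc.1 hn'.1
      exact Finset.mem_coe.2 (Finset.mem_filter.2
        ⟨Finset.mem_Ioc.2 ⟨by dsimp only; omega, by dsimp only; omega⟩, hn'.2⟩)
    · intro a _ b _ hab
      exact Nat.add_right_cancel hab
  rw [Nat.Ioc_filter_dvd_card_eq_div] at h1
  calc (((Finset.Icc 1 N).filter fun n => q ∣ n + h).card : ℝ) ≤ (((N + h) / q : ℕ) : ℝ) := by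
        exact_mod_cast h1
    _ ≤ _ := Nat.cast_div_le

lemma abs_longDivisorSum_le_div (h N : ℕ) {D : ℝ} (hD : 1 ≤ D) {k e : ℕ}
    (he : 0 < e) :
    |longDivisorSum h N D k e| ≤ Real.log N * Real.log ((N + h : ℕ) : ℝ)
      * (((N + h : ℕ) : ℝ) / (e * k ^ 2 : ℕ)) := by
  have hterm : ∀ n ∈ Finset.Icc 1 N, |if e * k ^ 2 ∣ n + h then
      theta n * lio (n + h) * Real.posLog (((n + h : ℕ) : ℝ) / (e * D)) else 0|
      ≤ if e * k ^ 2 ∣ n + h then Real.log N * Real.log ((N + h : ℕ) : ℝ) else 0 := by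
    intro n hn
    have hn' := Finset.mem_Icc.1 hn
    split_ifs
    · rw [abs_mul, abs_mul, abs_lio, mul_one, abs_of_nonneg (theta_nonneg n),
        abs_of_nonneg Real.posLog_nonneg]
      refine mul_le_mul ((theta_le_log n).trans (Real.log_le_log ?_ ?_))
        (le_trans (longWeight_mono h (by linarith) e hn'.2)
          (longWeight_le_log h hD he (by omega))) Real.posLog_nonneg (Real.log_natCast_nonneg N)
      · exact_mod_cast hn'.1
      · exact_mod_cast hn'.2
    · simp
  refine (Finset.abs_sum_le_sum_abs _ _).trans ((Finset.sum_le_sum hterm).trans ?_)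
  rw [← Finset.sum_filter, Finset.sum_const, nsmul_eq_mul, mul_comm]
  exact mul_le_mul_of_nonneg_left (card_filter_dvd_add_le h N _)
    (mul_nonneg (Real.log_natCast_nonneg N) (Real.log_natCast_nonneg _))

/-- The contribution of large squares. -/
lemma sum_longDivisorSum_tail_le (h N : ℕ) {D : ℝ} (hD : 1 ≤ D) {K : ℕ} (hK : 0 < K) :
    ∑ k ∈ Finset.Ioc K (N + h), ∑ e ∈ Finset.Icc 1 (N + h), |longDivisorSum h N D k e|
      ≤ Real.log N * Real.log ((N + h : ℕ) : ℝ) * ((N + h : ℕ) : ℝ)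
        * (1 + Real.log ((N + h : ℕ) : ℝ)) / K := by
  set Z := N + h
  have hlN := Real.log_natCast_nonneg N
  have hlZ := Real.log_natCast_nonneg Z
  have hharm : ∑ e ∈ Finset.Icc 1 Z, ((e : ℝ))⁻¹ ≤ 1 + Real.log (Z : ℝ) := by
    have := harmonic_le_one_add_log Z
    rw [harmonic_eq_sum_Icc] at this
    push_cast at this
    exact this
  have hsq : ∑ k ∈ Finset.Ioc K Z, (((k : ℝ)) ^ 2)⁻¹ ≤ (K : ℝ)⁻¹ := by
    rcases le_total K Z with hKZ | hZK
    · have := sum_Ioc_inv_sq_le_sub (α := ℝ) hK.ne' hKZ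
      have h0 : (0 : ℝ) ≤ (Z : ℝ)⁻¹ := by positivity
      linarith
    · rw [Finset.Ioc_eq_empty (by omega), Finset.sum_empty]
      positivity
  calc _ ≤ ∑ k ∈ Finset.Ioc K Z, ∑ e ∈ Finset.Icc 1 Z,
        (Real.log N * Real.log (Z : ℝ) * (Z : ℝ)) * (((e : ℝ))⁻¹ * (((k : ℝ)) ^ 2)⁻¹) := by
        refine Finset.sum_le_sum fun k _ => Finset.sum_le_sum fun e he => ?_
        refine (abs_longDivisorSum_le_div h N hD (Finset.mem_Icc.1 he).1).trans (le_of_eq ?_)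
        push_cast
        rw [div_eq_mul_inv, mul_inv]
        push_cast [Z]
        ring
    _ = (Real.log N * Real.log (Z : ℝ) * (Z : ℝ)) * ((∑ k ∈ Finset.Ioc K Z, (((k : ℝ)) ^ 2)⁻¹)
          * ∑ e ∈ Finset.Icc 1 Z, ((e : ℝ))⁻¹) := by
        rw [Finset.sum_mul_sum, Finset.mul_sum]
        refine Finset.sum_congr rfl fun k _ => ?_
        rw [Finset.mul_sum]
        refine Finset.sum_congr rfl fun e _ => ?_
        ring
    _ ≤ (Real.log N * Real.log (Z : ℝ) * (Z : ℝ)) * ((K : ℝ)⁻¹ * (1 + Real.log (Z : ℝ))) := by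
        gcongr
    _ = _ := by ring

/-- Weighted sums over the moduli `e * k ^ 2`, for `k` fixed, are controlled by the total
discrepancy over all moduli up to `y`. -/
lemma sum_maxAbs_mul_le {f : ℕ → ℝ} {k t Z : ℕ} (hk : 0 < k) {y W : ℝ} (hW : 0 ≤ W)
    {w : ℕ → ℝ} (hwW : ∀ e ∈ Finset.Icc 1 Z, w e ≤ W)
    (hw0 : ∀ e ∈ Finset.Icc 1 Z, y < e * k ^ 2 → w e = 0) :
    ∑ e ∈ Finset.Icc 1 Z, maxAbs f (e * k ^ 2) t * w e
      ≤ (∑ q ∈ Finset.Icc 1 ⌊y⌋₊, maxAbs f q t) * W := by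
  classical
  have hk2 : 0 < k ^ 2 := by positivity
  set E := (Finset.Icc 1 Z).filter fun e => e * k ^ 2 ≤ ⌊y⌋₊
  have h1 : ∑ e ∈ Finset.Icc 1 Z, maxAbs f (e * k ^ 2) t * w e
      = ∑ e ∈ E, maxAbs f (e * k ^ 2) t * w e := by
    symm
    refine Finset.sum_subset (Finset.filter_subset _ _) fun e he he' => ?_
    have h2 : ¬ e * k ^ 2 ≤ ⌊y⌋₊ := fun H => he' (Finset.mem_filter.2 ⟨he, H⟩)
    have h3 : y < ((e * k ^ 2 : ℕ) : ℝ) := Nat.lt_of_floor_lt (not_le.1 h2)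
    rw [hw0 e he (by exact_mod_cast h3), mul_zero]
  rw [h1, Finset.sum_mul]
  calc ∑ e ∈ E, maxAbs f (e * k ^ 2) t * w e ≤ ∑ e ∈ E, maxAbs f (e * k ^ 2) t * W :=
        Finset.sum_le_sum fun e he => mul_le_mul_of_nonneg_left
          (hwW e (Finset.mem_filter.1 he).1) (maxAbs_nonneg _ _ _)
    _ = ∑ q ∈ E.image (fun e => e * k ^ 2), maxAbs f q t * W := by
        rw [Finset.sum_image]
        intro a _ b _ hab
        exact Nat.eq_of_mul_eq_mul_right hk2 hab
    _ ≤ _ := by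
        refine Finset.sum_le_sum_of_subset_of_nonneg ?_ fun q _ _ =>
          mul_nonneg (maxAbs_nonneg _ _ _) hW
        intro q hq
        obtain ⟨e, he, rfl⟩ := Finset.mem_image.1 hq
        have he' := Finset.mem_filter.1 he
        exact Finset.mem_Icc.2 ⟨Nat.mul_pos (Finset.mem_Icc.1 he'.1).1 hk2, he'.2⟩

lemma two_mul_mul_sq_le {D t k K : ℝ} (ht : 0 < t) (htD : t ≤ D ^ 2) (hD : 0 < D)
    (hk : 0 ≤ k) (hkK : k ≤ K) (hKD : 4 * K ^ 4 ≤ D) :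
    2 * t * k ^ 2 ≤ D * t ^ (3 / 4 : ℝ) := by
  have h1 : t = t ^ (3 / 4 : ℝ) * t ^ (1 / 4 : ℝ) := by
    rw [← Real.rpow_add ht]; norm_num
  have h0 : 0 < t ^ (1 / 4 : ℝ) := Real.rpow_pos_of_pos ht _
  have h3 : 0 < t ^ (3 / 4 : ℝ) := Real.rpow_pos_of_pos ht _
  have h2 : (t ^ (1 / 4 : ℝ)) ^ 4 = t := by
    rw [← Real.rpow_natCast, ← Real.rpow_mul ht.le]; norm_num
  set u := t ^ (1 / 4 : ℝ)
  have hu : u ^ 2 ≤ D := by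
    refine (pow_le_pow_iff_left₀ (by positivity) hD.le two_ne_zero).1 ?_
    nlinarith
  have hkD : 4 * k ^ 4 ≤ D := le_trans (by gcongr) hKD
  have h4 : 2 * u * k ^ 2 ≤ D := by
    refine (pow_le_pow_iff_left₀ (by positivity) hD.le two_ne_zero).1 ?_
    calc (2 * u * k ^ 2) ^ 2 = u ^ 2 * (4 * k ^ 4) := by ring
      _ ≤ D * D := mul_le_mul hu hkD (by positivity) hD.le
      _ = D ^ 2 := by ring
  calc 2 * t * k ^ 2 = t ^ (3 / 4 : ℝ) * (2 * u * k ^ 2) := by nth_rewrite 1 [h1]; ring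
    _ ≤ t ^ (3 / 4 : ℝ) * D := by gcongr
    _ = _ := mul_comm _ _

/-- The contribution of a fixed small square. -/
lemma sum_longDivisorSum_le (h N : ℕ) {D β : ℝ} {K k : ℕ} (hk : 0 < k) (hkK : k ≤ K)
    (hDh : 2 * (h + 1) ≤ D) (hND : (N : ℝ) ≤ D ^ 2) (hDN : D ≤ N)
    (hKD : 4 * (K : ℝ) ^ 4 ≤ D)
    (hβ : ∀ t : ℕ, D / 2 ≤ t → t ≤ N → ∑ q ∈ Finset.Icc 1 ⌊(t : ℝ) ^ (3 / 4 : ℝ)⌋₊,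
      maxAbs (fun n => theta n * lio (n + h)) q t ≤ β * t) :
    ∑ e ∈ Finset.Icc 1 (N + h), |longDivisorSum h N D k e|
      ≤ β * N * (Real.log ((N + h : ℕ) : ℝ) + 1) := by
  set f := fun n => theta n * lio (n + h)
  have hh0 : (0 : ℝ) ≤ h := Nat.cast_nonneg h
  have hD1 : 1 ≤ D := by linarith
  have hD0 : 0 < D := by linarith
  have hN0 : (0 : ℝ) < N := by linarith
  have hN1 : 0 < N := by exact_mod_cast hN0
  have hβ0 : 0 ≤ β := by
    have h1 := hβ N (by linarith) le_rfl
    have h2 : 0 ≤ ∑ q ∈ Finset.Icc 1 ⌊(N : ℝ) ^ (3 / 4 : ℝ)⌋₊, maxAbs f q N :=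
      Finset.sum_nonneg fun q _ => maxAbs_nonneg _ _ _
    by_contra! H
    nlinarith
  have hlim : ∀ t e : ℕ, D / 2 ≤ t → t ≤ N → (t : ℝ) ^ (3 / 4 : ℝ) < e * k ^ 2 →
      (t : ℝ) + 1 + h ≤ e * D := by
    intro t e ht htN hlt
    have htN' : (t : ℝ) ≤ N := by exact_mod_cast htN
    have h1 := two_mul_mul_sq_le (D := D) (t := t) (k := k) (K := K) (by linarith)
      (htN'.trans hND) hD0 (by positivity) (by exact_mod_cast hkK) hKD
    have hk2 : (0 : ℝ) < (k : ℝ) ^ 2 := by positivity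
    have h2 : 2 * (t : ℝ) ≤ e * D := by
      refine le_of_mul_le_mul_right ?_ hk2
      nlinarith
    linarith
  have hsum : ∑ e ∈ Finset.Icc 1 (N + h), |longDivisorSum h N D k e|
      ≤ ∑ e ∈ Finset.Icc 1 (N + h), maxAbs f (e * k ^ 2) N * longWeight h D e N
        + ∑ t ∈ Finset.Ico 1 N, ∑ e ∈ Finset.Icc 1 (N + h), maxAbs f (e * k ^ 2) t
          * (longWeight h D e (t + 1) - longWeight h D e t) := by
    rw [Finset.sum_comm (s := Finset.Ico 1 N), ← Finset.sum_add_distrib]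
    exact Finset.sum_le_sum fun e he =>
      abs_longDivisorSum_le_maxAbs h N hD0.le hk (Finset.mem_Icc.1 he).1
  have hfirst : ∑ e ∈ Finset.Icc 1 (N + h), maxAbs f (e * k ^ 2) N * longWeight h D e N
      ≤ β * N * Real.log ((N + h : ℕ) : ℝ) := by
    have hl := Real.log_natCast_nonneg (N + h)
    refine (sum_maxAbs_mul_le (y := (N : ℝ) ^ (3 / 4 : ℝ)) hk hl (fun e he =>
      longWeight_le_log h hD1 (Finset.mem_Icc.1 he).1 hN1) fun e _ hlt => ?_).trans
      (mul_le_mul_of_nonneg_right (hβ N (by linarith) le_rfl) hl)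
    refine longWeight_eq_zero ?_
    have := hlim N e (by linarith) le_rfl hlt
    push_cast
    linarith
  have hsecond : ∀ t ∈ Finset.Ico 1 N, ∑ e ∈ Finset.Icc 1 (N + h), maxAbs f (e * k ^ 2) t
      * (longWeight h D e (t + 1) - longWeight h D e t) ≤ β := by
    intro t ht
    have ht' := Finset.mem_Ico.1 ht
    have ht0 : (0 : ℝ) < t := by exact_mod_cast ht'.1
    by_cases htD : D / 2 ≤ t
    · refine (sum_maxAbs_mul_le (y := (t : ℝ) ^ (3 / 4 : ℝ)) hk
        (one_div_nonneg.2 ht0.le) (fun e _ =>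
        longWeight_succ_sub_le h hD0 ht'.1) fun e _ hlt => ?_).trans
        ((mul_le_mul_of_nonneg_right (hβ t htD ht'.2.le) (one_div_nonneg.2 ht0.le)).trans
          (le_of_eq (by field_simp)))
      have := hlim t e htD ht'.2.le hlt
      rw [longWeight_eq_zero, longWeight_eq_zero, sub_zero]
      · push_cast; linarith
      · push_cast; linarith
    · refine le_trans (le_of_eq (Finset.sum_eq_zero fun e he => ?_)) hβ0
      have he1 : (1 : ℝ) ≤ e := by exact_mod_cast (Finset.mem_Icc.1 he).1
      have hle : (t : ℝ) + 1 + h ≤ e * D := by nlinarith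
      rw [longWeight_eq_zero, longWeight_eq_zero, sub_zero, mul_zero]
      · push_cast; linarith
      · push_cast; linarith
  have hthird : ∑ t ∈ Finset.Ico 1 N, ∑ e ∈ Finset.Icc 1 (N + h), maxAbs f (e * k ^ 2) t
      * (longWeight h D e (t + 1) - longWeight h D e t) ≤ β * N := by
    refine (Finset.sum_le_sum hsecond).trans ?_
    rw [Finset.sum_const, nsmul_eq_mul, Nat.card_Ico, mul_comm]
    refine mul_le_mul_of_nonneg_left ?_ hβ0
    exact_mod_cast Nat.sub_le N 1
  linarith

/-- Without prime pairs beyond `M`, the prime pair sum is supported on proper prime powers. -/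
lemma sum_theta_mul_vonMangoldt_le {h M : ℕ} (hpos : 0 < h)
    (hM : ∀ p : ℕ, M ≤ p → p.Prime → ¬ (p + h).Prime) (N : ℕ) :
    ∑ n ∈ Finset.Icc 1 N, theta n * ArithmeticFunction.vonMangoldt (n + h)
      ≤ (∑ n ∈ Finset.Icc 1 M, theta n * ArithmeticFunction.vonMangoldt (n + h))
        + Real.log N * (2 * √((N + h : ℕ) : ℝ) * Real.log ((N + h : ℕ) : ℝ)) := by
  have hlN := Real.log_natCast_nonneg N
  have hterm : ∀ n ∈ Finset.Icc 1 N, theta n * ArithmeticFunction.vonMangoldt (n + h)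
      ≤ (if n ∈ Finset.Icc 1 M then theta n * ArithmeticFunction.vonMangoldt (n + h) else 0)
        + Real.log N * if ¬ (n + h).Prime then ArithmeticFunction.vonMangoldt (n + h) else 0 := by
    intro n hn
    have hn' := Finset.mem_Icc.1 hn
    have hv : 0 ≤ ArithmeticFunction.vonMangoldt (n + h) :=
      ArithmeticFunction.vonMangoldt_nonneg
    have hθ := theta_nonneg n
    have hθN : theta n ≤ Real.log N := (theta_le_log n).trans
      (Real.log_le_log (by exact_mod_cast hn'.1) (by exact_mod_cast hn'.2))
    by_cases hnM : n ∈ Finset.Icc 1 M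
    · rw [if_pos hnM]
      refine le_add_of_nonneg_right (mul_nonneg hlN ?_)
      split_ifs <;> first | exact hv | exact le_rfl
    · rw [if_neg hnM, zero_add]
      have hMn : M ≤ n := by
        by_contra! H
        exact hnM (Finset.mem_Icc.2 ⟨hn'.1, H.le⟩)
      by_cases hp : n.Prime
      · rw [if_pos (hM n hMn hp)]
        exact mul_le_mul_of_nonneg_right hθN hv
      · have h0 : theta n = 0 := by simp [theta, hp]
        rw [h0, zero_mul]
        refine mul_nonneg hlN ?_
        split_ifs <;> first | exact hv | exact le_rfl
  refine (Finset.sum_le_sum hterm).trans ?_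
  rw [Finset.sum_add_distrib, ← Finset.mul_sum]
  refine add_le_add ?_ (mul_le_mul_of_nonneg_left ?_ hlN)
  · rw [← Finset.sum_filter]
    refine Finset.sum_le_sum_of_subset_of_nonneg
      (fun n hn => (Finset.mem_filter.1 hn).2) fun n _ _ =>
      mul_nonneg (theta_nonneg n) ArithmeticFunction.vonMangoldt_nonneg
  · have h1 : (1 : ℝ) ≤ ((N + h : ℕ) : ℝ) := by exact_mod_cast (by omega : 1 ≤ N + h)
    refine le_trans ?_ (Chebyshev.psi_sub_theta_le h1)
    rw [Chebyshev.psi_sub_theta_eq_sum_not_prime, Nat.floor_natCast, ← Finset.sum_filter]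
    have himg : ∑ n ∈ (Finset.Icc 1 N).filter (fun n => ¬ (n + h).Prime),
        ArithmeticFunction.vonMangoldt (n + h)
        = ∑ m ∈ ((Finset.Icc 1 N).filter (fun n => ¬ (n + h).Prime)).image (fun n => n + h),
          ArithmeticFunction.vonMangoldt m :=
      (Finset.sum_image fun a _ b _ hab => Nat.add_right_cancel hab).symm
    rw [himg]
    refine Finset.sum_le_sum_of_subset_of_nonneg ?_ fun n _ _ =>
      ArithmeticFunction.vonMangoldt_nonneg
    intro m hm
    obtain ⟨n, hn, rfl⟩ := Finset.mem_image.1 hm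
    have hn' := Finset.mem_filter.1 hn
    have hn1 := Finset.mem_Icc.1 hn'.1
    exact Finset.mem_filter.2 ⟨Finset.mem_Ioc.2 ⟨by omega, by omega⟩, hn'.2⟩

/-- Lower bound for the prime pair sum in terms of the truncated singular series. -/
lemma prime_pair_sum_ge (h N : ℕ) (hpos : 0 < h) {D β : ℝ} {K : ℕ} (hK : 0 < K)
    (hDh : 2 * (h + 1) ≤ D) (hND : (N : ℝ) ≤ D ^ 2) (hDN : D ≤ N)
    (hKD : 4 * (K : ℝ) ^ 4 ≤ D)
    (hβ : ∀ t : ℕ, D / 2 ≤ t → t ≤ N → ∑ q ∈ Finset.Icc 1 ⌊(t : ℝ) ^ (3 / 4 : ℝ)⌋₊,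
      maxAbs (fun n => theta n * lio (n + h)) q t ≤ β * t) :
    N * singPartial h D - Real.log D *
        (∑ d ∈ Finset.Icc 1 ⌊D⌋₊, primeMaxAbs d N + D * (h * Real.log h))
      - K * (β * N * (Real.log ((N + h : ℕ) : ℝ) + 1))
      - Real.log N * Real.log ((N + h : ℕ) : ℝ) * ((N + h : ℕ) : ℝ)
        * (1 + Real.log ((N + h : ℕ) : ℝ)) / K
      ≤ ∑ n ∈ Finset.Icc 1 N, theta n * ArithmeticFunction.vonMangoldt (n + h) := by
  have hh0 : (0 : ℝ) ≤ h := Nat.cast_nonneg h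
  have hD1 : 1 ≤ D := by linarith
  have h1 := short_divisor_sum_ge h N hpos hD1
  have h2 := sum_theta_mul_vonMangoldt_ge h N hpos (by linarith : 0 < D)
  have h3 := sum_longDivisorSum_tail_le h N hD1 hK
  have h4 : ∑ k ∈ Finset.Icc 1 K, ∑ e ∈ Finset.Icc 1 (N + h), |longDivisorSum h N D k e|
      ≤ K * (β * N * (Real.log ((N + h : ℕ) : ℝ) + 1)) := by
    refine (Finset.sum_le_sum fun k hk => sum_longDivisorSum_le h N (Finset.mem_Icc.1 hk).1
      (Finset.mem_Icc.1 hk).2 hDh hND hDN hKD hβ).trans ?_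
    rw [Finset.sum_const, nsmul_eq_mul, Nat.card_Icc, Nat.add_sub_cancel]
  have h5 : ∑ k ∈ Finset.Icc 1 (N + h), ∑ e ∈ Finset.Icc 1 (N + h), |longDivisorSum h N D k e|
      ≤ (∑ k ∈ Finset.Icc 1 K, ∑ e ∈ Finset.Icc 1 (N + h), |longDivisorSum h N D k e|)
        + ∑ k ∈ Finset.Ioc K (N + h), ∑ e ∈ Finset.Icc 1 (N + h), |longDivisorSum h N D k e| := by
    rw [← Finset.sum_union]
    · refine Finset.sum_le_sum_of_subset_of_nonneg ?_ fun k _ _ =>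
        Finset.sum_nonneg fun e _ => abs_nonneg _
      intro k hk
      have hk' := Finset.mem_Icc.1 hk
      rw [Finset.mem_union, Finset.mem_Icc, Finset.mem_Ioc]
      omega
    · rw [Finset.disjoint_left]
      intro k hk hk'
      exact absurd (Finset.mem_Icc.1 hk).2 (not_le.2 (Finset.mem_Ioc.1 hk').1)
  linarith

/-- The level of distribution of `θ(n) λ(n + h)`, made uniform over a polynomial range. -/
lemma sum_maxAbs_le_of_hasLevel {f : ℕ → ℝ} {C x : ℝ} (hC : 0 < C) (hx : 4 ≤ x)
    (hf : ∀ N : ℕ, 2 ≤ N → ∑ q ∈ Finset.Icc 1 ⌊(N : ℝ) ^ (3 / 4 : ℝ)⌋₊, maxAbs f q N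
      ≤ C * N / Real.log N ^ (6 : ℝ)) (t : ℕ) (ht : x / 2 ≤ t) :
    ∑ q ∈ Finset.Icc 1 ⌊(t : ℝ) ^ (3 / 4 : ℝ)⌋₊, maxAbs f q t
      ≤ 64 * C / Real.log x ^ 6 * t := by
  have hlx : 0 < Real.log x := Real.log_pos (by linarith)
  have ht2 : 2 ≤ t := by
    have : (2 : ℝ) ≤ t := by linarith
    exact_mod_cast this
  have hlt : Real.log x / 2 ≤ Real.log t := by
    rw [← Real.log_sqrt (by linarith)]
    refine Real.log_le_log (Real.sqrt_pos.2 (by linarith)) (le_trans ?_ ht)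
    rw [Real.sqrt_le_left (by linarith)]
    nlinarith
  refine (hf t ht2).trans ?_
  have h6 : Real.log t ^ (6 : ℝ) = Real.log t ^ 6 := by
    rw [← Real.rpow_natCast]; norm_num
  rw [h6]
  calc C * t / Real.log t ^ 6 ≤ C * t / (Real.log x / 2) ^ 6 := by
        have := pow_le_pow_left₀ (by positivity) hlt 6
        gcongr
    _ = _ := by field_simp; ring

/-- The final numerical inequality for the error terms at the scale `N ≈ x ^ 2`. -/
lemma error_terms_lt {x ℓ C C₁ C₀ H N L Λ Z P K S B : ℝ} (hℓ : 1 ≤ ℓ) (hx : ℓ ^ 3 ≤ x)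
    (hC : 0 < C) (hC₁ : 0 < C₁) (hC₀ : 0 ≤ C₀) (hH : 0 ≤ H)
    (hbig : 16 * (48 + 512 * C + C₁ + H + C₀ + 24) < ℓ)
    (hN1 : x ^ 2 / 2 ≤ N) (hN2 : N ≤ x ^ 2) (hL1 : ℓ ≤ L) (hL2 : L ≤ 2 * ℓ)
    (hΛ0 : 0 ≤ Λ) (hΛ : Λ ≤ 3 * ℓ) (hZ0 : 0 ≤ Z) (hZ : Z ≤ 2 * x ^ 2) (hP : P ≤ C₁ * N / L ^ 2)
    (hK1 : ℓ ^ 4 ≤ K) (hK2 : K ≤ 2 * ℓ ^ 4) (hS : 1 / 8 ≤ S) (hB : B ≤ 2 * x) (hB0 : 0 ≤ B) :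
    C₀ + L * (2 * B * Λ) < N * S - ℓ * (P + x * H)
      - K * (64 * C / ℓ ^ 6 * N * (Λ + 1)) - L * Λ * Z * (1 + Λ) / K := by
  have hℓ0 : 0 < ℓ := by linarith
  have hx1 : 1 ≤ x := le_trans (one_le_pow₀ hℓ) hx
  have hN0 : 0 ≤ N := by nlinarith
  have hL0 : 0 < L := by linarith
  have hℓx : ℓ ^ 3 * x ≤ x ^ 2 := by nlinarith
  have hX : 0 < x ^ 2 := by positivity
  have e1 : N * S ≥ x ^ 2 / 16 := by nlinarith
  have e2 : ℓ * P ≤ C₁ * (x ^ 2 / ℓ) := by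
    calc ℓ * P ≤ ℓ * (C₁ * x ^ 2 / ℓ ^ 2) := by
          refine mul_le_mul_of_nonneg_left (hP.trans ?_) hℓ0.le
          gcongr
      _ = _ := by field_simp
  have e3 : ℓ * (x * H) ≤ H * (x ^ 2 / ℓ) := by
    have : ℓ * x ≤ x ^ 2 / ℓ := by
      rw [le_div_iff₀ hℓ0]
      calc ℓ * x * ℓ = ℓ ^ 2 * x := by ring
        _ ≤ ℓ ^ 3 * x := by gcongr; linarith
        _ ≤ x ^ 2 := hℓx
    nlinarith
  have e4 : K * (64 * C / ℓ ^ 6 * N * (Λ + 1)) ≤ 512 * C * (x ^ 2 / ℓ) := by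
    calc K * (64 * C / ℓ ^ 6 * N * (Λ + 1))
        ≤ (2 * ℓ ^ 4) * (64 * C / ℓ ^ 6 * x ^ 2 * (4 * ℓ)) := by
          gcongr
          linarith
      _ = _ := by field_simp; ring
  have e5 : L * Λ * Z * (1 + Λ) / K ≤ 48 * (x ^ 2 / ℓ) := by
    calc L * Λ * Z * (1 + Λ) / K ≤ (2 * ℓ) * (3 * ℓ) * (2 * x ^ 2) * (4 * ℓ) / ℓ ^ 4 := by
          gcongr
          linarith
      _ = _ := by field_simp; ring
  have e6 : L * (2 * B * Λ) ≤ 24 * (x ^ 2 / ℓ) := by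
    have : ℓ ^ 2 * x ≤ x ^ 2 / ℓ := by
      rw [le_div_iff₀ hℓ0]
      linarith [hℓx]
    calc L * (2 * B * Λ) ≤ (2 * ℓ) * (2 * (2 * x) * (3 * ℓ)) := by gcongr
      _ = 24 * (ℓ ^ 2 * x) := by ring
      _ ≤ _ := by linarith
  have e7 : C₀ ≤ C₀ * (x ^ 2 / ℓ) := by
    refine le_mul_of_one_le_right hC₀ ?_
    rw [one_le_div hℓ0]
    calc ℓ ≤ ℓ ^ 3 := le_self_pow₀ hℓ (by norm_num)
      _ ≤ x := hx
      _ ≤ x ^ 2 := le_self_pow₀ hx1 (by norm_num)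
  have e8 : (48 + 512 * C + C₁ + H + C₀ + 24) * (x ^ 2 / ℓ) < x ^ 2 / 16 := by
    rw [mul_div_assoc', div_lt_div_iff₀ hℓ0 (by norm_num)]
    nlinarith
  nlinarith

lemma exists_large_log (c : ℝ) : ∃ X : ℝ, ∀ x, X ≤ x →
    c < Real.log x ∧ Real.log x ^ 17 ≤ x ∧ c ≤ x := by
  have h1 : ∀ᶠ x : ℝ in atTop, c < Real.log x := Real.tendsto_log_atTop.eventually_gt_atTop c
  have h2 : ∀ᶠ x : ℝ in atTop, Real.log x ^ 17 ≤ x := by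
    have := (Real.isLittleO_pow_log_id_atTop (n := 17)).bound (zero_lt_one)
    filter_upwards [this, eventually_ge_atTop 0] with x hx hx0
    rw [one_mul, Real.norm_eq_abs, Real.norm_eq_abs] at hx
    exact (le_abs_self _).trans (hx.trans (le_of_eq (abs_of_nonneg hx0)))
  obtain ⟨X, hX⟩ := eventually_atTop.1 (h1.and (h2.and (eventually_ge_atTop c)))
  exact ⟨X, hX⟩

/-- **Theorem 1.** If `ϑ > 3/4` and Hypothesis D(ϑ, h) holds for the positive even
integer `h`, then `p + h` is prime for infinitely many primes `p`. -/
theorem infinitely_many_prime_pairs (h : ℕ) (hpos : 0 < h) (heven : Even h)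
    (ϑ : ℝ) (hϑ : 3 / 4 < ϑ) (hD : HypD ϑ h) :
    ∀ M : ℕ, ∃ p : ℕ, M ≤ p ∧ p.Prime ∧ (p + h).Prime := by
  intro M
  by_contra! hM
  obtain ⟨C₁, hC₁, hprimes⟩ := hD.1 (ϑ - 3 / 4) (by linarith) 2 (by norm_num)
  obtain ⟨C, hC, hlevel⟩ := hD.2.2.2.1 (ϑ - 3 / 4) (by linarith) 6 (by norm_num)
  rw [sub_sub_cancel] at hprimes hlevel
  set C₀ := ∑ n ∈ Finset.Icc 1 M, theta n * ArithmeticFunction.vonMangoldt (n + h)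
  have hC₀ : 0 ≤ C₀ := Finset.sum_nonneg fun n _ =>
    mul_nonneg (theta_nonneg n) ArithmeticFunction.vonMangoldt_nonneg
  set H := (h : ℝ) * Real.log h
  have hH : 0 ≤ H := mul_nonneg (Nat.cast_nonneg h) (Real.log_natCast_nonneg h)
  have hh0 : (0 : ℝ) ≤ h := Nat.cast_nonneg h
  obtain ⟨X, hX⟩ := exists_large_log (16 * (48 + 512 * C + C₁ + H + C₀ + 24) + 2 * h)
  obtain ⟨x, hXx, hS⟩ := exists_eighth_le_singPartial h heven X
  obtain ⟨hℓbig, hℓx, hxbig⟩ := hX x hXx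
  set ℓ := Real.log x
  have hℓ64 : 64 ≤ ℓ := by nlinarith
  have hx4 : 4 ≤ x := by nlinarith
  have hx0 : 0 < x := by linarith
  set N := ⌊x ^ 2⌋₊
  have hN2 : (N : ℝ) ≤ x ^ 2 := Nat.floor_le (by positivity)
  have hN1 : x ^ 2 / 2 ≤ N := by
    have := Nat.lt_floor_add_one (x ^ 2)
    change x ^ 2 < (N : ℝ) + 1 at this
    nlinarith
  have hxN : x ≤ N := by nlinarith
  have hhx : 2 * ((h : ℝ) + 1) ≤ x := by nlinarith
  have hN2' : 2 ≤ N := by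
    have : (2 : ℝ) ≤ N := by linarith
    exact_mod_cast this
  have hL1 : ℓ ≤ Real.log N := Real.log_le_log hx0 hxN
  have hL2 : Real.log N ≤ 2 * ℓ := by
    calc Real.log N ≤ Real.log (x ^ 2) := Real.log_le_log (by linarith) hN2
      _ = 2 * ℓ := by rw [Real.log_pow]; norm_num [ℓ]
  have hZ : ((N + h : ℕ) : ℝ) ≤ 2 * x ^ 2 := by push_cast; nlinarith
  have hZ0 : (0 : ℝ) < ((N + h : ℕ) : ℝ) := by exact_mod_cast (by omega : 0 < N + h)
  have hΛ : Real.log ((N + h : ℕ) : ℝ) ≤ 3 * ℓ := by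
    calc Real.log ((N + h : ℕ) : ℝ) ≤ Real.log (x ^ 3) :=
          Real.log_le_log hZ0 (hZ.trans (by nlinarith [sq_nonneg x]))
      _ = 3 * ℓ := by rw [Real.log_pow]; norm_num [ℓ]
  set K := ⌈ℓ ^ 4⌉₊
  have hℓ4 : 1 ≤ ℓ ^ 4 := one_le_pow₀ (by linarith)
  have hK1 : ℓ ^ 4 ≤ K := Nat.le_ceil _
  have hK2 : (K : ℝ) ≤ 2 * ℓ ^ 4 := by
    have := Nat.ceil_lt_add_one (by positivity : 0 ≤ ℓ ^ 4)
    linarith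
  have hK0 : 0 < K := by
    have : (0 : ℝ) < K := by linarith
    exact_mod_cast this
  have hKD : 4 * (K : ℝ) ^ 4 ≤ x := by
    calc 4 * (K : ℝ) ^ 4 ≤ 4 * (2 * ℓ ^ 4) ^ 4 := by gcongr
      _ = 64 * ℓ ^ 16 := by ring
      _ ≤ ℓ * ℓ ^ 16 := by gcongr
      _ = ℓ ^ 17 := by ring
      _ ≤ x := hℓx
  have hP : ∑ d ∈ Finset.Icc 1 ⌊x⌋₊, primeMaxAbs d N ≤ C₁ * N / Real.log N ^ 2 := by
    have h2 : Real.log N ^ (2 : ℝ) = Real.log N ^ 2 := by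
      rw [← Real.rpow_natCast]; norm_num
    rw [← h2]
    refine le_trans (Finset.sum_le_sum_of_subset_of_nonneg ?_ fun d _ _ =>
      primeMaxAbs_nonneg d N) (hprimes N hN2')
    refine Finset.Icc_subset_Icc le_rfl (Nat.floor_le_floor ?_)
    have := two_mul_mul_sq_le (D := x) (t := N) (k := 1) (K := K) (by linarith) hN2 hx0
      zero_le_one (by exact_mod_cast hK0) hKD
    have h3 : x * x ≤ x * (N : ℝ) ^ (3 / 4 : ℝ) := by nlinarith
    exact le_of_mul_le_mul_left h3 hx0
  have hupper := sum_theta_mul_vonMangoldt_le hpos hM N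
  have hlower := prime_pair_sum_ge h N hpos hK0 hhx hN2 hxN hKD
    (fun t ht _ => sum_maxAbs_le_of_hasLevel hC hx4 hlevel t ht)
  have hB : √((N + h : ℕ) : ℝ) ≤ 2 * x := by
    rw [Real.sqrt_le_left (by linarith)]
    nlinarith
  have hfin := error_terms_lt (x := x) (ℓ := ℓ) (by linarith)
    ((pow_le_pow_right₀ (by linarith) (by norm_num)).trans hℓx) hC hC₁ hC₀ hH (by linarith)
    hN1 hN2 hL1 hL2 (Real.log_natCast_nonneg (N + h)) hΛ hZ0.le hZ hP hK1 hK2 hS hB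
    (Real.sqrt_nonneg _)
  linarith
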